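/- arXiv:2010.00376 — 2 statements merged into one kernel-verified Lean document; each statement's English description precedes it below -/
import Mathlib

section
/- Let s ∈ (0,1), u ∈ C^∞(ℝ^n) ∩ W^{1,∞}(ℝ^n), η ∈ C^∞(ℝ^n) ∩ W^{2,∞}(ℝ^n), σ > 0, and e ∈ ℝ^n with |e| = 1. Then there exists a constant σ₀, depending only on n and ‖η‖_{C²(ℝ^n)} (and in particular independent of s), such that whenever σ ≥ σ₀ one has, everywhere in ℝ^n, (-Δ)^s( η²(∂_e u)² + σ u² ) ≤ 2 η² ∂_e u · (-Δ)^s ∂_e u + 2 σ u · (-Δ)^s u. -/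
open MeasureTheory Filter Metric Set

noncomputable section

/-- Euclidean space `ℝⁿ`. -/
abbrev En (n : ℕ) := EuclideanSpace ℝ (Fin n)

/-- Principal value integral centered at `x`: the limit, as `ε → 0⁺`, of the integrals
over the complement of the `ε`-ball centered at `x`. -/
def pvAt (n : ℕ) (x : En n) (g : En n → ℝ) : ℝ :=
  limUnder (nhdsWithin (0:ℝ) (Set.Ioi 0))
    (fun ε => ∫ y in {y : En n | ε ≤ dist y x}, g y)

/-- Integro-differential operator with kernel `K`:
`𝓛_K u (x) = P.V. ∫ (u x - u y) K (x - y) dy`. -/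
def opK (n : ℕ) (K : En n → ℝ) (u : En n → ℝ) (x : En n) : ℝ :=
  pvAt n x (fun y => (u x - u y) * K (x - y))

/-- The normalizing constant `c_{n,s}` of the fractional Laplacian, for which the
Fourier symbol is `|ξ|^{2s}`. -/
def cns (n : ℕ) (s : ℝ) : ℝ :=
  (4:ℝ) ^ s * s * Real.Gamma ((n:ℝ)/2 + s) / (Real.pi ^ ((n:ℝ)/2) * Real.Gamma (1 - s))

/-- The fractional Laplacian `(-Δ)^s`, for `s ∈ (0,1)`. -/
def fracLap (n : ℕ) (s : ℝ) (u : En n → ℝ) (x : En n) : ℝ :=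
  opK n (fun z => cns n s * ‖z‖ ^ (-((n:ℝ) + 2*s))) u x

/-- Directional derivative `∂_e u`. -/
def dd (n : ℕ) (e : En n) (u : En n → ℝ) (x : En n) : ℝ := fderiv ℝ u x e

/-- `‖η‖_{C²(ℝⁿ)} ≤ M`. -/
def C2BddBy (n : ℕ) (η : En n → ℝ) (M : ℝ) : Prop :=
  ∀ x : En n, |η x| ≤ M ∧ ‖fderiv ℝ η x‖ ≤ M ∧ ‖fderiv ℝ (fderiv ℝ η) x‖ ≤ M

/-- Second-order Taylor estimates on a ball where the second derivative is bounded. -/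
lemma taylor_bounds_of_norm_fderiv_fderiv_le {n : ℕ} {f : En n → ℝ} (hf : ContDiff ℝ 2 f)
    {x : En n} {ρ C : ℝ} (hC : ∀ y ∈ closedBall x ρ, ‖fderiv ℝ (fderiv ℝ f) y‖ ≤ C)
    {z : En n} (hz : ‖z‖ ≤ ρ) :
    ‖fderiv ℝ f (x + z) - fderiv ℝ f x‖ ≤ C * ‖z‖ ∧
      |f (x + z) - f x - fderiv ℝ f x z| ≤ C * ‖z‖ ^ 2 := by
  have hρ : 0 ≤ ρ := (norm_nonneg z).trans hz
  have hx : x ∈ closedBall x ρ := mem_closedBall_self hρ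
  have hC0 : 0 ≤ C := (norm_nonneg (fderiv ℝ (fderiv ℝ f) x)).trans (hC x hx)
  have hdf : ContDiff ℝ 1 (fderiv ℝ f) := hf.fderiv_right (by norm_num)
  have hlip : ∀ y ∈ closedBall x ρ, ‖fderiv ℝ f y - fderiv ℝ f x‖ ≤ C * ‖y - x‖ := fun y hy =>
    (convex_closedBall x ρ).norm_image_sub_le_of_norm_fderiv_le
      (fun w _ => hdf.differentiable one_ne_zero w) hC hx hy
  refine ⟨?_, ?_⟩
  · simpa using hlip (x + z) (by simpa using hz)
  · have h := (convex_closedBall x ‖z‖).norm_image_sub_le_of_norm_fderiv_le'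
      (f := f) (φ := fderiv ℝ f x) (C := C * ‖z‖) (x := x) (y := x + z)
      (fun w _ => hf.differentiable two_ne_zero w)
      (fun w hw => (hlip w (closedBall_subset_closedBall hz hw)).trans
        (mul_le_mul_of_nonneg_left (by simpa [dist_eq_norm] using hw) hC0))
      (mem_closedBall_self (norm_nonneg z)) (by simp)
    rw [add_sub_cancel_left, Real.norm_eq_abs] at h
    exact h.trans_eq (by ring)

/-- Symmetric second differences of a bounded `C²` function are `O(min 1 ‖z‖²)`. -/
lemma exists_abs_second_difference_le {n : ℕ} {f : En n → ℝ} (hf : ContDiff ℝ 2 f) {B : ℝ}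
    (hB : ∀ y, |f y| ≤ B) (x : En n) :
    ∃ C : ℝ, ∀ z, |2 * f x - f (x + z) - f (x - z)| ≤ C * min 1 (‖z‖ ^ 2) := by
  have hdf : ContDiff ℝ 1 (fderiv ℝ f) := hf.fderiv_right (by norm_num)
  have hcont : Continuous fun y => ‖fderiv ℝ (fderiv ℝ f) y‖ :=
    (continuous_norm (E := En n →L[ℝ] En n →L[ℝ] ℝ)).comp (hdf.continuous_fderiv one_ne_zero)
  obtain ⟨D, hD⟩ : ∃ D : ℝ, ∀ y ∈ closedBall x 1, ‖fderiv ℝ (fderiv ℝ f) y‖ ≤ D := by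
    obtain ⟨D, hD⟩ := (isCompact_closedBall x (1 : ℝ)).bddAbove_image hcont.continuousOn
    exact ⟨D, fun y hy => hD (mem_image_of_mem _ hy)⟩
  have hD0 : 0 ≤ D :=
    (norm_nonneg (fderiv ℝ (fderiv ℝ f) x)).trans (hD x (mem_closedBall_self zero_le_one))
  have hB0 : 0 ≤ B := (abs_nonneg _).trans (hB x)
  refine ⟨2 * D + 4 * B, fun z => ?_⟩
  rcases le_total ‖z‖ 1 with hz | hz
  · have h1 := (taylor_bounds_of_norm_fderiv_fderiv_le hf hD hz).2
    have h2 := (taylor_bounds_of_norm_fderiv_fderiv_le hf hD (z := -z) (by simpa using hz)).2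
    rw [← sub_eq_add_neg, map_neg, norm_neg] at h2
    rw [min_eq_right (by nlinarith [norm_nonneg z])]
    rw [abs_le] at *
    have : 0 ≤ B * ‖z‖ ^ 2 := by positivity
    constructor <;> linarith [h1.1, h1.2, h2.1, h2.2]
  · rw [min_eq_left (by nlinarith)]
    have h1 := abs_le.1 (hB x)
    have h2 := abs_le.1 (hB (x + z))
    have h3 := abs_le.1 (hB (x - z))
    rw [abs_le]
    constructor <;> linarith [h1.1, h1.2, h2.1, h2.2, h3.1, h3.2]

lemma integrable_min_one_norm_sq_mul_rpow {n : ℕ} (hn : 0 < n) {s : ℝ} (hs : s ∈ Ioo (0 : ℝ) 1) :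
    Integrable (fun z : En n => min 1 (‖z‖ ^ 2) * ‖z‖ ^ (-((n : ℝ) + 2 * s))) := by
  have : Nonempty (Fin n) := ⟨⟨0, hn⟩⟩
  have : Nontrivial (En n) := inferInstance
  rw [integrable_fun_norm_addHaar volume
    (f := fun r : ℝ => min 1 (r ^ 2) * r ^ (-((n : ℝ) + 2 * s)))]
  have hpow : ∀ r : ℝ, 0 < r → r ^ (n - 1) * r ^ (-((n : ℝ) + 2 * s)) = r ^ (-1 - 2 * s) := by
    intro r hr
    rw [← Real.rpow_natCast, ← Real.rpow_add hr, Nat.cast_pred hn]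
    ring_nf
  rw [finrank_euclideanSpace_fin, ← Ioc_union_Ioi_eq_Ioi zero_le_one]
  refine IntegrableOn.union ?_ ?_
  · have h : IntegrableOn (fun r : ℝ => r ^ (1 - 2 * s)) (Ioc 0 1) :=
      (intervalIntegrable_iff_integrableOn_Ioc_of_le zero_le_one).1
        (intervalIntegral.intervalIntegrable_rpow' (by linarith [hs.2]))
    refine h.congr_fun (fun r hr => ?_) measurableSet_Ioc
    have h2 : r ^ (1 - 2 * s) = r ^ 2 * r ^ (-1 - 2 * s) := by
      rw [← Real.rpow_natCast, ← Real.rpow_add hr.1]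
      norm_num
      ring_nf
    simp only [smul_eq_mul]
    rw [min_eq_right (by nlinarith [hr.1, hr.2]), mul_left_comm, hpow r hr.1, h2]
  · refine (integrableOn_Ioi_rpow_of_lt (a := -1 - 2 * s) (by linarith [hs.1])
      zero_lt_one).congr_fun (fun r hr => ?_) measurableSet_Ioi
    simp only [smul_eq_mul]
    rw [min_eq_left (by nlinarith [mem_Ioi.1 hr]), one_mul, hpow r (zero_lt_one.trans hr)]

lemma integral_eq_half_symm {n : ℕ} {h : En n → ℝ} (hh : Integrable h) :
    ∫ z, h z = 2⁻¹ * ∫ z, (h z + h (-z)) := by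
  rw [integral_add hh hh.comp_neg, integral_neg_eq_self]
  ring

/-- If even kernels `k ε` are dominated by and converge to `‖z‖^{-(n+2s)}`, the corresponding
nonlocal operators converge to the symmetrized singular integral. -/
lemma tendsto_integral_sub_mul_kernel {n : ℕ} (hn : 0 < n) {s : ℝ} (hs : s ∈ Ioo (0 : ℝ) 1)
    {f : En n → ℝ} (hf : ContDiff ℝ 2 f) {B : ℝ} (hB : ∀ y, |f y| ≤ B) (x : En n)
    (k : ℝ → En n → ℝ) (hint : ∀ ε > 0, Integrable (k ε))
    (heven : ∀ ε z, k ε (-z) = k ε z)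
    (hbound : ∀ ε > 0, ∀ z ≠ 0, |k ε z| ≤ ‖z‖ ^ (-((n : ℝ) + 2 * s)))
    (hlim : ∀ z ≠ 0, Tendsto (fun ε => k ε z) (nhdsWithin 0 (Ioi 0))
      (nhds (‖z‖ ^ (-((n : ℝ) + 2 * s))))) :
    Tendsto (fun ε => ∫ z, (f x - f (x + z)) * k ε z) (nhdsWithin 0 (Ioi 0))
      (nhds (2⁻¹ * ∫ z, (2 * f x - f (x + z) - f (x - z)) * ‖z‖ ^ (-((n : ℝ) + 2 * s)))) := by
  have : Nonempty (Fin n) := ⟨⟨0, hn⟩⟩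
  have : Nontrivial (En n) := inferInstance
  obtain ⟨C, hC⟩ := exists_abs_second_difference_le hf hB x
  have hcf : Continuous f := hf.continuous
  have hne : ∀ᵐ z : En n, z ≠ 0 := by
    simp [ae_iff]
  have hsymm : ∀ ε > 0, ∫ z, (f x - f (x + z)) * k ε z =
      2⁻¹ * ∫ z, (2 * f x - f (x + z) - f (x - z)) * k ε z := by
    intro ε hε
    rw [integral_eq_half_symm]
    · congr 2
      ext z
      rw [heven, ← sub_eq_add_neg]
      ring
    · refine (hint ε hε).bdd_mul (c := 2 * B) (by fun_prop) (.of_forall fun z => ?_)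
      rw [Real.norm_eq_abs]
      exact (abs_sub _ _).trans (by linarith [hB x, hB (x + z)])
  refine Tendsto.congr' (f₁ := fun ε =>
    2⁻¹ * ∫ z, (2 * f x - f (x + z) - f (x - z)) * k ε z)
    (eventually_nhdsWithin_of_forall fun ε hε => (hsymm ε hε).symm) ?_
  refine Tendsto.const_mul _ ?_
  refine tendsto_integral_filter_of_dominated_convergence
    (fun z => C * (min 1 (‖z‖ ^ 2) * ‖z‖ ^ (-((n : ℝ) + 2 * s)))) ?_ ?_
    ((integrable_min_one_norm_sq_mul_rpow hn hs).const_mul C) ?_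
  · filter_upwards [self_mem_nhdsWithin] with ε hε
    exact (Continuous.aestronglyMeasurable (by fun_prop)).mul (hint ε hε).1
  · filter_upwards [self_mem_nhdsWithin] with ε hε
    filter_upwards [hne] with z hz
    rw [norm_mul, ← mul_assoc]
    exact mul_le_mul (hC z) (hbound ε hε z hz) (norm_nonneg _) ((abs_nonneg _).trans (hC z))
  · filter_upwards [hne] with z hz
    exact (hlim z hz).const_mul _

/-- The smooth regularization `(δ² + ‖z‖²)^{-α/2}` of the kernel `‖z‖^{-α}`. -/
def regKernel (n : ℕ) (α δ : ℝ) (z : En n) : ℝ := (δ ^ 2 + ‖z‖ ^ 2) ^ (-α / 2)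

lemma continuous_regKernel {n : ℕ} {α δ : ℝ} (hδ : 0 < δ) : Continuous (regKernel n α δ) := by
  unfold regKernel
  exact Continuous.rpow_const (by fun_prop) fun z => Or.inl (by positivity)

lemma integrable_regKernel {n : ℕ} {α δ : ℝ} (hα : (n : ℝ) < α) (hδ : 0 < δ) :
    Integrable (regKernel n α δ) := by
  have h : Integrable (fun z : En n => ((1 : ℝ) + ‖z‖ ^ 2) ^ (-α / 2)) :=
    integrable_rpow_neg_one_add_norm_sq (by simpa using hα)
  have h2 := (h.comp_smul (R := δ⁻¹) (by positivity)).const_mul ((δ ^ 2) ^ (-α / 2))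
  refine h2.congr (.of_forall fun z => ?_)
  simp only [regKernel]
  rw [← Real.mul_rpow (by positivity) (by positivity), norm_smul, norm_inv, Real.norm_eq_abs,
    abs_of_pos hδ]
  congr 1
  field_simp

lemma norm_rpow_eq_sq_rpow {n : ℕ} (α : ℝ) (z : En n) :
    ‖z‖ ^ (-α) = (‖z‖ ^ 2) ^ (-α / 2) := by
  rw [← Real.rpow_natCast, ← Real.rpow_mul (norm_nonneg z)]
  congr 1
  push_cast
  ring

lemma regKernel_nonneg {n : ℕ} (α δ : ℝ) (z : En n) : 0 ≤ regKernel n α δ z := by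
  unfold regKernel
  positivity

lemma tendsto_integral_sub_mul_regKernel {n : ℕ} (hn : 0 < n) {s : ℝ} (hs : s ∈ Ioo (0 : ℝ) 1)
    {f : En n → ℝ} (hf : ContDiff ℝ 2 f) {B : ℝ} (hB : ∀ y, |f y| ≤ B) (x : En n) :
    Tendsto (fun δ => ∫ z, (f x - f (x + z)) * regKernel n ((n : ℝ) + 2 * s) δ z)
      (nhdsWithin 0 (Ioi 0))
      (nhds (2⁻¹ * ∫ z, (2 * f x - f (x + z) - f (x - z)) * ‖z‖ ^ (-((n : ℝ) + 2 * s)))) := by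
  refine tendsto_integral_sub_mul_kernel hn hs hf hB x _
    (fun ε hε => integrable_regKernel (by linarith [hs.1]) hε) (fun ε z => by simp [regKernel])
    (fun ε hε z hz => ?_) (fun z hz => ?_)
  · have hz' : 0 < ‖z‖ := norm_pos_iff.2 hz
    rw [abs_of_nonneg (regKernel_nonneg _ _ _), norm_rpow_eq_sq_rpow, regKernel]
    refine Real.rpow_le_rpow_of_nonpos (by positivity) (by nlinarith) ?_
    have := hs.1
    have : (0 : ℝ) ≤ n := Nat.cast_nonneg n
    linarith
  · have hz' : 0 < ‖z‖ := norm_pos_iff.2 hz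
    rw [norm_rpow_eq_sq_rpow]
    have h : ContinuousAt (fun δ : ℝ => regKernel n ((n : ℝ) + 2 * s) δ z) 0 := by
      unfold regKernel
      exact ContinuousAt.rpow_const (by fun_prop) (Or.inl (by positivity))
    have h2 := h.tendsto.mono_left (nhdsWithin_le_nhds (s := Ioi (0 : ℝ)))
    simpa [regKernel] using h2

lemma fracLap_eq {n : ℕ} (hn : 0 < n) {s : ℝ} (hs : s ∈ Ioo (0 : ℝ) 1)
    {f : En n → ℝ} (hf : ContDiff ℝ 2 f) {B : ℝ} (hB : ∀ y, |f y| ≤ B) (x : En n) :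
    fracLap n s f x = cns n s *
      (2⁻¹ * ∫ z, (2 * f x - f (x + z) - f (x - z)) * ‖z‖ ^ (-((n : ℝ) + 2 * s))) := by
  have hα : (0 : ℝ) < (n : ℝ) + 2 * s := by
    have := hs.1
    positivity
  have hmeas : ∀ ε : ℝ, MeasurableSet {z : En n | ε ≤ ‖z‖} := fun ε =>
    measurableSet_le measurable_const measurable_norm
  have key := tendsto_integral_sub_mul_kernel hn hs hf hB x
    (fun ε => {z : En n | ε ≤ ‖z‖}.indicator fun z => ‖z‖ ^ (-((n : ℝ) + 2 * s)))
    (fun ε hε => ?_) (fun ε z => by simp [indicator]) (fun ε hε z hz => ?_) (fun z hz => ?_)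
  · unfold fracLap opK pvAt
    refine Tendsto.limUnder_eq ?_
    refine (key.const_mul (cns n s)).congr fun ε => ?_
    have hset : MeasurableSet {y : En n | ε ≤ dist y x} :=
      measurableSet_le measurable_const (by fun_prop)
    rw [← integral_indicator hset, ← integral_const_mul,
      ← integral_add_left_eq_self ({y : En n | ε ≤ dist y x}.indicator _) x]
    congr 1
    ext z
    by_cases h : ε ≤ ‖z‖
    · simp [indicator, h]
      ring
    · simp [indicator, h]
  · have h1 := (integrable_regKernel (n := n) (α := (n : ℝ) + 2 * s) (by linarith [hs.1])
      one_pos).const_mul ((1 + (ε⁻¹) ^ 2) ^ (((n : ℝ) + 2 * s) / 2))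
    rw [integrable_indicator_iff (hmeas ε)]
    refine h1.integrableOn.mono' (Measurable.aestronglyMeasurable (by fun_prop)) ?_
    refine (ae_restrict_iff' (hmeas ε)).2 (.of_forall fun z hz => ?_)
    have hz : ε ≤ ‖z‖ := hz
    have hε : 0 < ε := hε
    have hz' : 0 < ‖z‖ := hε.trans_le hz
    rw [Real.norm_of_nonneg (by positivity), norm_rpow_eq_sq_rpow, regKernel]
    have h2 : 1 + ‖z‖ ^ 2 ≤ (1 + (ε⁻¹) ^ 2) * ‖z‖ ^ 2 := by
      have : 1 ≤ ε⁻¹ * ‖z‖ := by rw [inv_mul_eq_div, one_le_div hε]; exact hz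
      nlinarith
    have h3 := Real.rpow_le_rpow (by positivity) h2 (z := ((n : ℝ) + 2 * s) / 2) (by positivity)
    rw [Real.mul_rpow (by positivity) (by positivity)] at h3
    rw [neg_div, Real.rpow_neg (by positivity), Real.rpow_neg (by positivity), ← div_eq_mul_inv,
      one_pow, le_div_iff₀ (by positivity), inv_mul_le_iff₀ (by positivity),
      mul_comm (_ ^ _)]
    exact h3
  · by_cases h : ε ≤ ‖z‖
    · simp only [indicator, mem_ofPred_eq, h, if_true]
      rw [abs_of_nonneg (by positivity)]
    · simp only [indicator, mem_ofPred_eq, h, if_false, abs_zero]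
      positivity
  · refine tendsto_const_nhds.congr' ?_
    filter_upwards [nhdsWithin_le_nhds (Iio_mem_nhds (norm_pos_iff.2 hz))] with ε hε
    simp [indicator, le_of_lt (mem_Iio.1 hε)]

lemma mul_le_one_of_mul_one_add_sq {τ w : ℝ} (hw : w * (1 + τ ^ 2) = 1) :
    0 < w ∧ w ≤ 1 ∧ τ * w ≤ 1 ∧ τ ^ 2 * w ≤ 1 := by
  have hw0 : 0 < w := by
    by_contra! h
    nlinarith [sq_nonneg τ]
  refine ⟨hw0, by nlinarith [sq_nonneg τ], ?_, by nlinarith⟩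
  nlinarith [sq_nonneg (τ - 1), sq_nonneg τ]

lemma abs_sq_sub_mul_le {a b l τ w : ℝ} (hw : w * (1 + τ ^ 2) = 1)
    (hl : |l| ≤ |a| * τ) (hb : |b - a - l| ≤ |a| * τ ^ 2) :
    |a ^ 2 - b * (a - l) * w ^ 2| ≤ 5 * a ^ 2 * τ ^ 2 * w := by
  obtain ⟨hw0, hw1, hw2, hw3⟩ := mul_le_one_of_mul_one_add_sq hw
  have hA := abs_nonneg a
  have key : a ^ 2 - b * (a - l) * w ^ 2 =
      a ^ 2 * τ ^ 2 * w * (1 + w) + l ^ 2 * w ^ 2 - (b - a - l) * (a - l) * w ^ 2 := by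
    linear_combination (-a ^ 2 * (1 + w)) * hw
  have h1 : |a ^ 2 * τ ^ 2 * w * (1 + w)| ≤ 2 * (a ^ 2 * τ ^ 2 * w) := by
    rw [abs_of_nonneg (by positivity)]
    nlinarith [show 0 ≤ a ^ 2 * τ ^ 2 * w by positivity]
  have h2 : |l ^ 2 * w ^ 2| ≤ a ^ 2 * τ ^ 2 * w := by
    rw [abs_of_nonneg (by positivity)]
    have : l ^ 2 ≤ a ^ 2 * τ ^ 2 := by
      rw [← sq_abs l, ← sq_abs a, ← mul_pow]
      gcongr
    have hww : w ^ 2 ≤ w := by nlinarith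
    exact mul_le_mul this hww (by positivity) (by positivity)
  have h3 : |(b - a - l) * (a - l) * w ^ 2| ≤ 2 * (a ^ 2 * τ ^ 2 * w) := by
    rw [abs_mul, abs_mul, abs_of_nonneg (sq_nonneg w)]
    have : |a - l| ≤ |a| * (1 + τ) := (abs_sub _ _).trans (by linarith)
    calc |b - a - l| * |a - l| * w ^ 2 ≤ (|a| * τ ^ 2) * (|a| * (1 + τ)) * w ^ 2 := by gcongr
      _ = (|a| ^ 2 * τ ^ 2 * w) * (w + τ * w) := by ring
      _ ≤ (|a| ^ 2 * τ ^ 2 * w) * 2 := by gcongr; linarith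
      _ = 2 * (a ^ 2 * τ ^ 2 * w) := by
        rw [sq_abs]
        ring
  rw [key]
  calc _ ≤ |a ^ 2 * τ ^ 2 * w * (1 + w)| + |l ^ 2 * w ^ 2| + |(b - a - l) * (a - l) * w ^ 2| :=
        (abs_sub _ _).trans (add_le_add_left (abs_add_le _ _) _)
    _ ≤ _ := by linarith

lemma abs_deriv_weight_le {a b l g β τ w r c : ℝ} (hw : w * (1 + τ ^ 2) = 1) (hτ : 0 ≤ τ)
    (hr : 0 < r) (hr1 : r ≤ 1) (hl : |l| ≤ |a| * τ) (hb : |b - a - l| ≤ |a| * τ ^ 2)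
    (hg : |g| ≤ |a| / r) (hβ : |β - g| ≤ |a| * τ) (hc : |c| ≤ r * τ) :
    |β * (a - l) * w ^ 2 - b * g * w ^ 2 - b * (a - l) * (4 * c / r ^ 2) * w ^ 3| ≤
      21 * (a ^ 2 / r) * τ * w := by
  obtain ⟨hw0, hw1, hw2, hw3⟩ := mul_le_one_of_mul_one_add_sq hw
  have hA := abs_nonneg a
  have hal : |a - l| ≤ |a| * (1 + τ) := (abs_sub _ _).trans (by linarith)
  have hb' : |b| ≤ |a| * (1 + τ + τ ^ 2) := by
    have h : b = (b - a - l) + a + l := by ring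
    rw [h]
    exact (abs_add_three _ _ _).trans (by linarith)
  have hlr : |2 * l + (b - a - l)| ≤ |a| * (2 * τ + τ ^ 2) := by
    refine (abs_add_le _ _).trans ?_
    rw [abs_mul, abs_two]
    linarith
  have key : β * (a - l) * w ^ 2 - b * g * w ^ 2 - b * (a - l) * (4 * c / r ^ 2) * w ^ 3 =
      (β - g) * (a - l) * w ^ 2 - g * (2 * l + (b - a - l)) * w ^ 2
        - b * (a - l) * (4 * c / r ^ 2) * w ^ 3 := by ring
  have hX : 0 ≤ |a| ^ 2 / r * τ * w := by positivity
  have h1 : |(β - g) * (a - l) * w ^ 2| ≤ 2 * (|a| ^ 2 / r * τ * w) := by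
    rw [abs_mul, abs_mul, abs_of_nonneg (sq_nonneg w)]
    have : |a| ^ 2 ≤ |a| ^ 2 / r := le_div_self (sq_nonneg _) hr hr1
    calc |β - g| * |a - l| * w ^ 2 ≤ (|a| * τ) * (|a| * (1 + τ)) * w ^ 2 := by gcongr
      _ = (|a| ^ 2 * τ * w) * (w + τ * w) := by ring
      _ ≤ (|a| ^ 2 / r * τ * w) * 2 := by gcongr; linarith
      _ = _ := by ring
  have h2 : |g * (2 * l + (b - a - l)) * w ^ 2| ≤ 3 * (|a| ^ 2 / r * τ * w) := by
    rw [abs_mul, abs_mul, abs_of_nonneg (sq_nonneg w)]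
    calc |g| * |2 * l + (b - a - l)| * w ^ 2
        ≤ (|a| / r) * (|a| * (2 * τ + τ ^ 2)) * w ^ 2 := by gcongr
      _ = (|a| ^ 2 / r * τ * w) * (2 * w + τ * w) := by ring
      _ ≤ (|a| ^ 2 / r * τ * w) * 3 := by gcongr; linarith
      _ = _ := by ring
  have h3 : |b * (a - l) * (4 * c / r ^ 2) * w ^ 3| ≤ 16 * (|a| ^ 2 / r * τ * w) := by
    rw [abs_mul, abs_mul, abs_mul, abs_of_nonneg (pow_nonneg hw0.le 3), abs_div, abs_mul,
      abs_of_nonneg (sq_nonneg r), abs_of_pos (four_pos : (0 : ℝ) < 4)]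
    calc |b| * |a - l| * (4 * |c| / r ^ 2) * w ^ 3
        ≤ (|a| * (1 + τ + τ ^ 2)) * (|a| * (1 + τ)) * (4 * (r * τ) / r ^ 2) * w ^ 3 := by gcongr
      _ = 4 * (|a| ^ 2 / r * τ * w) * ((w + τ * w + τ ^ 2 * w) * (w + τ * w)) := by
        field_simp
      _ ≤ 4 * (|a| ^ 2 / r * τ * w) * (2 * 2) := by
        have e1 : w + τ * w + τ ^ 2 * w ≤ 2 := by nlinarith
        have e2 : w + τ * w ≤ 2 := by linarith
        gcongr
      _ = _ := by ring
  rw [key]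
  calc _ ≤ |(β - g) * (a - l) * w ^ 2| + |g * (2 * l + (b - a - l)) * w ^ 2|
          + |b * (a - l) * (4 * c / r ^ 2) * w ^ 3| :=
        (abs_sub _ _).trans (add_le_add_left (abs_sub _ _) _)
    _ ≤ 21 * (|a| ^ 2 / r * τ * w) := by linarith
    _ = _ := by rw [sq_abs]; ring

/-- Pointwise completion of squares behind the Bernstein inequality. -/
lemma bernstein_pointwise {a b l τ w r U V V₀ K Q' C σ : ℝ} (hw : w * (1 + τ ^ 2) = 1)
    (hr : 0 < r) (hl : |l| ≤ |a| * τ) (hK : 0 ≤ K)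
    (hQ' : |Q'| ≤ C * (a ^ 2 / r) * τ * w * K) (hσ : C ^ 2 * (|a| / r) ^ 2 ≤ σ) :
    (2 * a ^ 2 * V₀ * V - a ^ 2 * V₀ ^ 2 - b ^ 2 * V ^ 2 - σ * U ^ 2) * K ≤
      2 * V₀ * ((a ^ 2 - b * (a - l) * w ^ 2) * K * V + Q' * U)
        - 2 * a * V₀ ^ 2 * (l * w ^ 4 * K) := by
  obtain ⟨hw0, hw1, hw2, hw3⟩ := mul_le_one_of_mul_one_add_sq hw
  have hl2 : l ^ 2 ≤ a ^ 2 * τ ^ 2 := by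
    rw [← sq_abs l, ← sq_abs a, ← mul_pow]
    gcongr
  have heven : a ^ 2 * τ ^ 2 * w ≤ a ^ 2 * (1 - w ^ 4) - l ^ 2 * w ^ 4 := by
    have e1 : 1 - w = τ ^ 2 * w := by linarith
    have e2 : 1 - w ^ 4 = τ ^ 2 * w * (1 + w + w ^ 2 + w ^ 3) := by rw [← e1]; ring
    have e3 : l ^ 2 * w ^ 4 ≤ a ^ 2 * τ ^ 2 * w ^ 4 := by gcongr
    rw [e2]
    have e4 : 0 ≤ a ^ 2 * τ ^ 2 * w * (w + w ^ 2) := by positivity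
    linarith
  have hcross : -(w * K * (V₀ ^ 2 * a ^ 2 * τ ^ 2 + σ * U ^ 2)) ≤ 2 * V₀ * (Q' * U) := by
    have h1 : |2 * V₀ * (Q' * U)| ≤ 2 * |V₀| * (C * (a ^ 2 / r) * τ * w * K * |U|) := by
      rw [abs_mul, abs_mul, abs_mul, abs_two]
      gcongr
    have h2 : 2 * |V₀| * (C * (a ^ 2 / r) * τ * w * K * |U|) =
        w * K * (2 * (|V₀| * |a| * τ) * (C * (|a| / r) * |U|)) := by
      rw [← sq_abs a]
      field_simp
    have h3 : 2 * (|V₀| * |a| * τ) * (C * (|a| / r) * |U|) ≤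
        V₀ ^ 2 * a ^ 2 * τ ^ 2 + σ * U ^ 2 := by
      have h4 := two_mul_le_add_sq (|V₀| * |a| * τ) (C * (|a| / r) * |U|)
      have h5 : C ^ 2 * (|a| / r) ^ 2 * |U| ^ 2 ≤ σ * |U| ^ 2 := by gcongr
      calc _ ≤ _ := h4
        _ = |V₀| ^ 2 * |a| ^ 2 * τ ^ 2 + C ^ 2 * (|a| / r) ^ 2 * |U| ^ 2 := by ring
        _ ≤ |V₀| ^ 2 * |a| ^ 2 * τ ^ 2 + σ * |U| ^ 2 := by linarith
        _ = _ := by simp only [sq_abs]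
    have h6 := mul_le_mul_of_nonneg_left h3 (mul_nonneg hw0.le hK)
    linarith [neg_abs_le (2 * V₀ * (Q' * U))]
  have hσ0 : 0 ≤ σ := le_trans (by positivity) hσ
  have hlast : w * K * (σ * U ^ 2) ≤ K * (σ * U ^ 2) := by
    have : 0 ≤ K * (σ * U ^ 2) := by positivity
    nlinarith
  have h7 : 0 ≤ (b * V - (a - l) * w ^ 2 * V₀) ^ 2 * K := by positivity
  have h8 := mul_le_mul_of_nonneg_left heven (show 0 ≤ V₀ ^ 2 * K by positivity)
  linarith

lemma hasLineDerivAt_norm_sq {n : ℕ} (z e : En n) :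
    HasDerivAt (fun t : ℝ => ‖z + t • e‖ ^ 2) (2 * inner ℝ z e) 0 := by
  have h : HasDerivAt (fun t : ℝ => z + t • e) e 0 := by
    simpa using ((hasDerivAt_id (0 : ℝ)).smul_const e).const_add z
  simpa using h.norm_sq

lemma hasLineDerivAt_regKernel {n : ℕ} {α δ : ℝ} (hδ : 0 < δ) (z e : En n) :
    HasLineDerivAt ℝ (regKernel n α δ)
      (-(α * inner ℝ z e / (δ ^ 2 + ‖z‖ ^ 2)) * regKernel n α δ z) z e := by
  have hpos : 0 < δ ^ 2 + ‖z‖ ^ 2 := by positivity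
  have h := ((hasLineDerivAt_norm_sq z e).const_add (δ ^ 2)).rpow_const (p := -α / 2)
    (Or.inl (by simpa using hpos.ne'))
  refine h.congr_deriv ?_
  simp only [zero_smul, add_zero, regKernel]
  rw [Real.rpow_sub_one hpos.ne']
  ring

lemma hasLineDerivAt_comp_add {n : ℕ} {f : En n → ℝ} (hf : Differentiable ℝ f) (x z e : En n) :
    HasLineDerivAt ℝ (fun z => f (x + z)) (fderiv ℝ f (x + z) e) z e :=
  (((hf (x + z)).hasFDerivAt.comp z ((hasFDerivAt_id z).const_add x))).hasLineDerivAt e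

lemma hasLineDerivAt_cutoff {n : ℕ} (r : ℝ) (z e : En n) :
    HasLineDerivAt ℝ (fun z : En n => ((1 + ‖z‖ ^ 2 / r ^ 2)⁻¹) ^ 2)
      (-(4 * inner ℝ z e / r ^ 2) * ((1 + ‖z‖ ^ 2 / r ^ 2)⁻¹) ^ 3) z e := by
  have hpos : 0 < 1 + ‖z‖ ^ 2 / r ^ 2 := by positivity
  have h := ((((hasLineDerivAt_norm_sq z e).div_const (r ^ 2)).const_add 1).fun_inv
    (by simpa using hpos.ne')).fun_pow 2
  refine h.congr_deriv ?_
  simp only [zero_smul, add_zero]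
  generalize 1 + ‖z‖ ^ 2 / r ^ 2 = W
  rw [div_eq_mul_inv _ (W ^ 2), ← inv_pow]
  push_cast
  ring

/-- The Bernstein inequality for the regularized kernel. -/
lemma integral_bernstein_regKernel_nonpos {n : ℕ} {s : ℝ} (hs : s ∈ Ioo (0 : ℝ) 1)
    {u η : En n → ℝ} (hu : ContDiff ℝ 2 u) {B : ℝ} (hB : ∀ x, |u x| ≤ B ∧ ‖fderiv ℝ u x‖ ≤ B)
    (hη : ContDiff ℝ 2 η) {M : ℝ} (hM : C2BddBy n η M) {e : En n} (he : ‖e‖ = 1)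
    {σ : ℝ} (hσ0 : 0 ≤ σ) (hσ : (5 * (n + 2) + 21) ^ 2 * M ^ 2 ≤ σ) (x : En n)
    {δ : ℝ} (hδ : 0 < δ) :
    ∫ z, (2 * η x ^ 2 * dd n e u x * dd n e u (x + z) - η x ^ 2 * dd n e u x ^ 2
      - η (x + z) ^ 2 * dd n e u (x + z) ^ 2 - σ * (u (x + z) - u x) ^ 2)
        * regKernel n (n + 2 * s) δ z ≤ 0 := by
  set K := regKernel n (n + 2 * s) δ with hKdef
  have hK0 : ∀ z, 0 ≤ K z := regKernel_nonneg _ _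
  have hKc : Continuous K := continuous_regKernel hδ
  have hKi : Integrable K := integrable_regKernel (by linarith [hs.1]) hδ
  rcases eq_or_ne (η x) 0 with ha | ha
  · refine integral_nonpos fun z => mul_nonpos_of_nonpos_of_nonneg ?_ (hK0 z)
    rw [ha]
    have := mul_nonneg hσ0 (sq_nonneg (u (x + z) - u x))
    have := mul_nonneg (sq_nonneg (η (x + z))) (sq_nonneg (dd n e u (x + z)))
    linarith
  set a := η x with hadef
  have ha0 : 0 < |a| := abs_pos.2 ha
  have hM0 : 0 < M := ha0.trans_le (hM x).1
  set r := |a| / M with hrdef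
  have hr : 0 < r := div_pos ha0 hM0
  have hr1 : r ≤ 1 := (div_le_one hM0).2 (hM x).1
  have har : |a| / r = M := by rw [hrdef]; field_simp
  have hMr : M * r = |a| := by rw [hrdef]; field_simp
  set L := fderiv ℝ η x with hL
  set V := dd n e u with hV
  -- abbreviations for the functions of `z`
  let w : En n → ℝ := fun z => (1 + ‖z‖ ^ 2 / r ^ 2)⁻¹
  let q : En n → ℝ := fun z => a ^ 2 - η (x + z) * (a - L z) * w z ^ 2
  let q' : En n → ℝ := fun z => fderiv ℝ η (x + z) e * (a - L z) * w z ^ 2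
    - η (x + z) * L e * w z ^ 2 - η (x + z) * (a - L z) * (4 * inner ℝ z e / r ^ 2) * w z ^ 3
  let K' : En n → ℝ := fun z => -((n + 2 * s) * inner ℝ z e / (δ ^ 2 + ‖z‖ ^ 2)) * K z
  let Q' : En n → ℝ := fun z => -q' z * K z + q z * K' z
  let U : En n → ℝ := fun z => u (x + z) - u x
  have hw : ∀ z, w z * (1 + (‖z‖ / r) ^ 2) = 1 := fun z => by
    rw [div_pow]
    exact inv_mul_cancel₀ (by positivity)
  have hτ : ∀ z : En n, 0 ≤ ‖z‖ / r := fun z => by positivity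
  have hMz : ∀ z : En n, M * ‖z‖ = |a| * (‖z‖ / r) := fun z => by rw [← har]; ring
  have hl : ∀ z, |L z| ≤ |a| * (‖z‖ / r) := fun z => by
    rw [← hMz]
    exact L.le_of_opNorm_le (hM x).2.1 z
  have htaylor := fun z => taylor_bounds_of_norm_fderiv_fderiv_le hη (x := x) (ρ := ‖z‖) (z := z)
    (fun y _ => (hM y).2.2) le_rfl
  have hb : ∀ z, |η (x + z) - a - L z| ≤ |a| * (‖z‖ / r) ^ 2 := fun z => by
    refine (htaylor z).2.trans ?_
    have : |a| * (‖z‖ / r) ^ 2 = M * ‖z‖ ^ 2 / r := by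
      rw [← hMr]
      field_simp
    rw [this]
    exact le_div_self (by positivity) hr hr1
  have hβ : ∀ z, |fderiv ℝ η (x + z) e - L e| ≤ |a| * (‖z‖ / r) := fun z => by
    rw [← hMz]
    have := (fderiv ℝ η (x + z) - L).le_of_opNorm_le (htaylor z).1 e
    rwa [he, mul_one] at this
  have hg : |L e| ≤ |a| / r := by
    rw [har]
    have := L.le_of_opNorm_le (hM x).2.1 e
    rwa [he, mul_one] at this
  have hin : ∀ z, |inner ℝ z e| ≤ ‖z‖ := fun z => by
    simpa [he] using abs_real_inner_le_norm z e
  have hc : ∀ z, |inner ℝ z e| ≤ r * (‖z‖ / r) := fun z => by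
    rw [mul_div_cancel₀ _ hr.ne']
    exact hin z
  have hw01 := fun z => mul_le_one_of_mul_one_add_sq (hw z)
  have hqb : ∀ z, |q z| ≤ 5 * a ^ 2 * (‖z‖ / r) ^ 2 * w z := fun z =>
    abs_sq_sub_mul_le (hw z) (hl z) (hb z)
  have hq'b : ∀ z, |q' z| ≤ 21 * (a ^ 2 / r) * (‖z‖ / r) * w z := fun z =>
    abs_deriv_weight_le (hw z) (hτ z) hr hr1 (hl z) (hb z) hg (hβ z) (hc z)
  have hα0 : 0 ≤ (n : ℝ) + 2 * s := by have := hs.1; positivity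
  have hQ'b : ∀ z, |Q' z| ≤ (5 * (n + 2) + 21) * (a ^ 2 / r) * (‖z‖ / r) * w z * K z := by
    intro z
    have h1 : |-q' z * K z| ≤ 21 * (a ^ 2 / r) * (‖z‖ / r) * w z * K z := by
      rw [abs_mul, abs_neg, abs_of_nonneg (hK0 z)]
      exact mul_le_mul_of_nonneg_right (hq'b z) (hK0 z)
    have h2 : |q z * K' z| ≤ (5 * (n + 2)) * (a ^ 2 / r) * (‖z‖ / r) * w z * K z := by
      have hpos : 0 < δ ^ 2 + ‖z‖ ^ 2 := by positivity
      have hK' : |K' z| ≤ (n + 2) * ‖z‖ / (δ ^ 2 + ‖z‖ ^ 2) * K z := by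
        simp only [K']
        rw [abs_mul, abs_neg, abs_div, abs_mul, abs_of_nonneg hα0, abs_of_nonneg hpos.le,
          abs_of_nonneg (hK0 z)]
        have h3 : (n : ℝ) + 2 * s ≤ n + 2 := by linarith [hs.2]
        have h4 := hK0 z
        have h5 := hin z
        gcongr
      have hw0 := (hw01 z).1.le
      have h4 := hK0 z
      rw [abs_mul]
      calc |q z| * |K' z| ≤ (5 * a ^ 2 * (‖z‖ / r) ^ 2 * w z)
            * ((n + 2) * ‖z‖ / (δ ^ 2 + ‖z‖ ^ 2) * K z) := by
              gcongr
              exact hqb z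
        _ = (5 * (n + 2)) * (a ^ 2 / r) * (‖z‖ / r) * w z * K z
            * (‖z‖ ^ 2 / (δ ^ 2 + ‖z‖ ^ 2)) := by field_simp
        _ ≤ _ := by
          refine mul_le_of_le_one_right (by positivity) ?_
          rw [div_le_one hpos]
          nlinarith
    calc |Q' z| ≤ _ := abs_add_le _ _
      _ ≤ _ := by linarith
  -- continuity
  have hηc : Continuous η := hη.continuous
  have hη'c : Continuous (fderiv ℝ η) := hη.continuous_fderiv two_ne_zero
  have huc : Continuous u := hu.continuous
  have hu'c : Continuous (fderiv ℝ u) := hu.continuous_fderiv two_ne_zero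
  have hVc : Continuous V := by
    simp only [hV]
    unfold dd
    fun_prop
  have hwc : Continuous w := Continuous.inv₀ (by fun_prop) fun z => by positivity
  have hqc : Continuous q := by fun_prop
  have hq'c : Continuous q' := by fun_prop
  have hK'c : Continuous K' := by
    refine Continuous.mul (Continuous.neg (Continuous.div (by fun_prop) (by fun_prop) ?_)) hKc
    intro z
    positivity
  have hQ'c : Continuous Q' := by fun_prop
  have hUc : Continuous U := by fun_prop
  -- integrability
  have hint : ∀ {f : En n → ℝ} (C : ℝ), Continuous f → (∀ z, |f z| ≤ C * K z) → Integrable f :=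
    fun C hf hC => (hKi.const_mul C).mono' hf.aestronglyMeasurable (.of_forall hC)
  have hVb : ∀ y, |V y| ≤ B := fun y => by
    have := (fderiv ℝ u y).le_of_opNorm_le (hB y).2 e
    rwa [he, mul_one] at this
  have hUb : ∀ z, |U z| ≤ 2 * B := fun z =>
    (abs_sub _ _).trans (by linarith [(hB (x + z)).1, (hB x).1])
  have hB0 : 0 ≤ B := (abs_nonneg _).trans (hB x).1
  have hqb' : ∀ z, |q z| ≤ 5 * a ^ 2 := fun z => by
    refine (hqb z).trans ?_
    rw [mul_assoc]
    exact mul_le_of_le_one_right (by positivity) (hw01 z).2.2.2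
  have hqKb : ∀ z, |q z * K z| ≤ 5 * a ^ 2 * K z := fun z => by
    rw [abs_mul, abs_of_nonneg (hK0 z)]
    exact mul_le_mul_of_nonneg_right (hqb' z) (hK0 z)
  have hQ'b' : ∀ z, |Q' z| ≤ (5 * (n + 2) + 21) * (a ^ 2 / r) * K z := fun z => by
    refine (hQ'b z).trans (mul_le_mul_of_nonneg_right ?_ (hK0 z))
    rw [mul_assoc]
    exact mul_le_of_le_one_right (by positivity) (hw01 z).2.2.1
  have hi1 : Integrable fun z => q z * K z * V (x + z) :=
    hint (5 * a ^ 2 * B) (by fun_prop) fun z => by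
      rw [abs_mul, mul_right_comm _ B]
      exact mul_le_mul (hqKb z) (hVb _) (abs_nonneg _) ((abs_nonneg _).trans (hqKb z))
  have hi2 : Integrable fun z => Q' z * U z :=
    hint ((5 * (n + 2) + 21) * (a ^ 2 / r) * (2 * B)) (by fun_prop) fun z => by
      rw [abs_mul, mul_right_comm _ (2 * B)]
      exact mul_le_mul (hQ'b' z) (hUb z) (abs_nonneg _) ((abs_nonneg _).trans (hQ'b' z))
  have hi12 : Integrable fun z => q z * K z * V (x + z) + Q' z * U z := hi1.add hi2
  have hi3 : Integrable fun z => q z * K z * U z :=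
    hint (5 * a ^ 2 * (2 * B)) (by fun_prop) fun z => by
      rw [abs_mul, mul_right_comm _ (2 * B)]
      exact mul_le_mul (hqKb z) (hUb z) (abs_nonneg _) ((abs_nonneg _).trans (hqKb z))
  have hi4 : Integrable fun z => L z * w z ^ 4 * K z :=
    hint |a| (by fun_prop) fun z => by
      rw [abs_mul, abs_mul, abs_of_nonneg (hK0 z),
        abs_of_nonneg (pow_nonneg (hw01 z).1.le 4)]
      refine mul_le_mul_of_nonneg_right ?_ (hK0 z)
      have h1 : w z ^ 4 ≤ w z := by
        simpa using pow_le_pow_of_le_one (hw01 z).1.le (hw01 z).2.1 (show 1 ≤ 4 by norm_num)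
      calc |L z| * w z ^ 4 ≤ |a| * (‖z‖ / r) * w z :=
            mul_le_mul (hl z) h1 (pow_nonneg (hw01 z).1.le 4) (by positivity)
        _ = |a| * (‖z‖ / r * w z) := by ring
        _ ≤ |a| := mul_le_of_le_one_right ha0.le (hw01 z).2.2.1
  -- the two terms with vanishing integral
  have hodd : ∫ z, L z * w z ^ 4 * K z = 0 := by
    have h := integral_neg_eq_self (fun z => L z * w z ^ 4 * K z) volume
    simp only [w, hKdef, regKernel, map_neg, norm_neg, neg_mul, integral_neg] at h ⊢
    linarith
  have hdiffη : Differentiable ℝ η := hη.differentiable two_ne_zero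
  have hqK : ∀ z, HasLineDerivAt ℝ (fun z => q z * K z) (Q' z) z e := by
    intro z
    have h1 := hasLineDerivAt_comp_add hdiffη x z e
    have h2 : HasLineDerivAt ℝ (fun z => a - L z) (-L e) z e :=
      (L.hasFDerivAt.const_sub a).hasLineDerivAt e
    have h3 := ((h1.mul h2).mul (hasLineDerivAt_cutoff r z e)).const_sub (a ^ 2)
    have h4 := h3.mul (hasLineDerivAt_regKernel (α := n + 2 * s) hδ z e)
    refine h4.congr_deriv ?_
    simp only [zero_smul, add_zero, Q', q', q, K', w, Pi.mul_apply]
    ring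
  have hUder : ∀ z, HasLineDerivAt ℝ U (V (x + z)) z e := fun z =>
    (hasLineDerivAt_comp_add (hu.differentiable two_ne_zero) x z e).sub_const (u x)
  have hparts : ∫ z, q z * K z * V (x + z) = -∫ z, Q' z * U z :=
    integral_bilinear_hasLineDerivAt_right_eq_neg_left_of_integrable
      (B := ContinuousLinearMap.mul ℝ ℝ) hi2 hi1 hi3 (fun z _ => hqK z) (fun z _ => hUder z)
  have hrhs : ∫ z, (2 * V x * (q z * K z * V (x + z) + Q' z * U z)
      - 2 * a * V x ^ 2 * (L z * w z ^ 4 * K z)) = 0 := by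
    rw [integral_sub (hi12.const_mul _) (hi4.const_mul _), integral_const_mul,
      integral_const_mul, integral_add hi1 hi2, hparts, hodd]
    ring
  by_cases hlhs : Integrable fun z => (2 * a ^ 2 * V x * V (x + z) - a ^ 2 * V x ^ 2
      - η (x + z) ^ 2 * V (x + z) ^ 2 - σ * (u (x + z) - u x) ^ 2) * K z
  · rw [← hrhs]
    refine integral_mono hlhs ((hi12.const_mul _).sub (hi4.const_mul _)) fun z => ?_
    exact bernstein_pointwise (hw z) hr (hl z) (hK0 z) (hQ'b z) (by rwa [har])
  · exact (integral_undef hlhs).le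

lemma cns_nonneg {n : ℕ} {s : ℝ} (hs : s ∈ Ioo (0 : ℝ) 1) : 0 ≤ cns n s := by
  have h1 : 0 < Real.Gamma ((n : ℝ) / 2 + s) := by
    have := hs.1
    exact Real.Gamma_pos_of_pos (by positivity)
  have h2 : 0 < Real.Gamma (1 - s) := Real.Gamma_pos_of_pos (by linarith [hs.2])
  have := hs.1
  unfold cns
  positivity

/-- Bernstein key inequality for the fractional Laplacian.
For every `n` there is a constant `σ₀`, depending only on `n` and on (a bound `M` for)
`‖η‖_{C²(ℝⁿ)}` — in particular independent of `s ∈ (0,1)` — such that for every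
`u ∈ C^∞ ∩ W^{1,∞}`, `η ∈ C^∞ ∩ W^{2,∞}`, every unit vector `e`, and every `σ ≥ σ₀`,
`(-Δ)^s (η² (∂_e u)² + σ u²) ≤ 2 η² ∂_e u (-Δ)^s ∂_e u + 2 σ u (-Δ)^s u` everywhere. -/
theorem bernstein_fracLap_key_inequality (n : ℕ) (hn : 0 < n) :
    ∃ σ₀ : ℝ → ℝ, (∀ M : ℝ, 0 < σ₀ M) ∧
      ∀ (s : ℝ), s ∈ Set.Ioo (0:ℝ) 1 →
      ∀ (u η : En n → ℝ),
        ContDiff ℝ (⊤ : ℕ∞) u →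
        (∃ Mu : ℝ, ∀ x, |u x| ≤ Mu ∧ ‖fderiv ℝ u x‖ ≤ Mu) →
        ContDiff ℝ (⊤ : ℕ∞) η →
      ∀ (M : ℝ), C2BddBy n η M →
      ∀ (e : En n), ‖e‖ = 1 →
      ∀ (σ : ℝ), 0 < σ → σ₀ M ≤ σ →
      ∀ x : En n,
        fracLap n s (fun y => (η y)^2 * (dd n e u y)^2 + σ * (u y)^2) x ≤
          2 * (η x)^2 * dd n e u x * fracLap n s (dd n e u) x
            + 2 * σ * u x * fracLap n s u x := by
  refine ⟨fun M => (5 * (n + 2) + 21) ^ 2 * M ^ 2 + 1, fun M => by positivity, ?_⟩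
  rintro s hs u η hu ⟨B, hB⟩ hη M hM e he σ hσ0 hσ x
  have hu2 : ContDiff ℝ 2 u := contDiff_infty.1 hu 2
  have hη2 : ContDiff ℝ 2 η := contDiff_infty.1 hη 2
  have hV2 : ContDiff ℝ 2 (dd n e u) :=
    ((contDiff_infty.1 hu 3).fderiv_right (m := 2) (by norm_num)).clm_apply contDiff_const
  have hVb : ∀ y, |dd n e u y| ≤ B := fun y => by
    have := (fderiv ℝ u y).le_of_opNorm_le (hB y).2 e
    rwa [he, mul_one] at this
  have hΦ2 : ContDiff ℝ 2 fun y => η y ^ 2 * dd n e u y ^ 2 + σ * u y ^ 2 := by fun_prop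
  have hΦb : ∀ y, |η y ^ 2 * dd n e u y ^ 2 + σ * u y ^ 2| ≤ M ^ 2 * B ^ 2 + σ * B ^ 2 := by
    intro y
    have h1 := sq_le_sq' (abs_le.1 (hM y).1).1 (abs_le.1 (hM y).1).2
    have h2 := sq_le_sq' (abs_le.1 (hVb y)).1 (abs_le.1 (hVb y)).2
    have h3 := sq_le_sq' (abs_le.1 (hB y).1).1 (abs_le.1 (hB y).1).2
    rw [abs_of_nonneg (by positivity)]
    gcongr
  have hub : ∀ y, |u y| ≤ B := fun y => (hB y).1
  rw [fracLap_eq hn hs hΦ2 hΦb, fracLap_eq hn hs hV2 hVb, fracLap_eq hn hs hu2 hub]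
  have tΦ := tendsto_integral_sub_mul_regKernel hn hs hΦ2 hΦb x
  have tV := tendsto_integral_sub_mul_regKernel hn hs hV2 hVb x
  have tu := tendsto_integral_sub_mul_regKernel hn hs hu2 hub x
  have hle := le_of_tendsto_of_tendsto tΦ
    ((tV.const_mul (2 * η x ^ 2 * dd n e u x)).add (tu.const_mul (2 * σ * u x))) ?_
  · have := mul_le_mul_of_nonneg_left hle (cns_nonneg (n := n) hs)
    linarith
  · filter_upwards [self_mem_nhdsWithin] with δ hδ
    have hint : ∀ {f : En n → ℝ} {C : ℝ}, ContDiff ℝ 2 f → (∀ y, |f y| ≤ C) →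
        Integrable fun z => (f x - f (x + z)) * regKernel n (n + 2 * s) δ z := by
      intro f C hf hC
      have := hf.continuous
      refine (integrable_regKernel (by linarith [hs.1]) hδ).bdd_mul (c := 2 * C)
        (by fun_prop) (.of_forall fun z => ?_)
      rw [Real.norm_eq_abs]
      exact (abs_sub _ _).trans (by linarith [hC x, hC (x + z)])
    have hmain := integral_bernstein_regKernel_nonpos hs hu2 hB hη2 hM he hσ0.le
      (by linarith only [hσ]) x hδ
    have hsum : Integrable fun z =>
        2 * η x ^ 2 * dd n e u x * ((dd n e u x - dd n e u (x + z)) * regKernel n (n + 2 * s) δ z)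
          + 2 * σ * u x * ((u x - u (x + z)) * regKernel n (n + 2 * s) δ z) :=
      ((hint hV2 hVb).const_mul _).add ((hint hu2 hub).const_mul _)
    rw [← integral_const_mul, ← integral_const_mul,
      ← integral_add ((hint hV2 hVb).const_mul _) ((hint hu2 hub).const_mul _), ← sub_nonpos,
      ← integral_sub (hint hΦ2 hΦb) hsum]
    refine le_of_eq_of_le (integral_congr_ae (.of_forall fun z => ?_)) hmain
    ring
end
end

section
/- Let K satisfy the evenness and two-sided power bounds and the derivative bounds, and let 𝓛_K be the associated integro-differential operator. Let u ∈ C^∞(ℝ^n) ∩ W^{1,∞}(ℝ^n) and η ∈ C^∞(ℝ^n) ∩ W^{2,∞}(ℝ^n). Then for every ε > 0 there exists a constant σ_ε > 0, depending only on ε, ‖η‖_{C²(ℝ^n)}, and the structural constants n, s, C₁, C₂, C₃, such that 𝓛_K( η²(∂_e u)² + σ_ε u² ) ≤ 2 η² ∂_e u · 𝓛_K ∂_e u + 2 σ_ε u · 𝓛_K u + ε² ‖∂_e u‖²_{L^∞(B₃)} everywhere in B₂, for every e ∈ ℝ^n with |e| = 1. -/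
open MeasureTheory Filter Metric Set

noncomputable section

/-- Second directional derivative `∂²_e u`. -/
def dd2 (n : ℕ) (e : En n) (u : En n → ℝ) (x : En n) : ℝ := fderiv ℝ (dd n e u) x e

/-- The kernel `K` is even and has two-sided power bounds with constants `C₁ ≤ C₂`:
`K(z) = K(-z)` and `C₁ s(1-s)|z|^{-n-2s} ≤ K(z) ≤ C₂ s(1-s)|z|^{-n-2s}` for `z ≠ 0`. -/
def evenPowKernel (n : ℕ) (s C₁ C₂ : ℝ) (K : En n → ℝ) : Prop :=
  (∀ z : En n, z ≠ 0 → K z = K (-z)) ∧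
  (∀ z : En n, z ≠ 0 →
    C₁ * (s * (1 - s)) * ‖z‖ ^ (-((n:ℝ) + 2*s)) ≤ K z ∧
    K z ≤ C₂ * (s * (1 - s)) * ‖z‖ ^ (-((n:ℝ) + 2*s)))

/-- `K ∈ C²(ℝⁿ \ {0})` with `|z||∇K(z)| + |z|²|D²K(z)| ≤ C₃ K(z)` for `z ≠ 0`. -/
def kernelDerivBdd (n : ℕ) (C₃ : ℝ) (K : En n → ℝ) : Prop :=
  ContDiffOn ℝ 2 K {z : En n | z ≠ 0} ∧
  ∀ z : En n, z ≠ 0 →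
    ‖z‖ * ‖fderiv ℝ K z‖ + ‖z‖^2 * ‖fderiv ℝ (fderiv ℝ K) z‖ ≤ C₃ * K z

lemma measurableSet_le_norm (n : ℕ) (δ : ℝ) : MeasurableSet {z : En n | δ ≤ ‖z‖} :=
  measurableSet_le measurable_const measurable_norm

lemma integrableOn_norm_rpow_compl_ball (n : ℕ) {p δ : ℝ} (hp : (n : ℝ) < p) (hδ : 0 < δ) :
    IntegrableOn (fun z : En n => ‖z‖ ^ (-p)) {z | δ ≤ ‖z‖} := by
  have h := (integrable_one_add_norm (E := En n) (μ := volume) (r := p)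
    (by simpa using hp)).const_mul ((1 + 1 / δ) ^ p)
  refine Integrable.mono' h.integrableOn ?_ ?_
  · exact (measurable_norm.pow_const _).aestronglyMeasurable
  · refine (ae_restrict_iff' (measurableSet_le_norm n δ)).2 (ae_of_all _ fun z hz => ?_)
    have hz' : δ ≤ ‖z‖ := hz
    have hzp : 0 < ‖z‖ := hδ.trans_le hz'
    rw [Real.norm_of_nonneg (by positivity), Real.rpow_neg (by positivity),
      Real.rpow_neg (by positivity), ← div_eq_mul_inv, ← Real.div_rpow (by positivity)
      (by positivity), ← Real.inv_rpow (by positivity)]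
    refine Real.rpow_le_rpow (by positivity) ?_ (by have := n.cast_nonneg (α := ℝ); linarith)
    rw [inv_eq_one_div, div_le_div_iff₀ hzp (by positivity)]
    have : 1 ≤ 1 / δ * ‖z‖ := by
      rw [one_div, inv_mul_eq_div, one_le_div hδ]; exact hz'
    nlinarith

lemma integrableOn_sq_mul_norm_rpow_ball (n : ℕ) (hn : 0 < n) {s : ℝ} (hs : s < 1) (r : ℝ) :
    IntegrableOn (fun z : En n => ‖z‖ ^ 2 * ‖z‖ ^ (-((n : ℝ) + 2 * s))) (ball 0 r) := by
  refine integrableOn_ball_of_norm_le_rpow (C := 1) (α := (n : ℝ) + 2 * s - 2)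
    (by simpa using Nat.succ_le_of_lt hn) (by simp; linarith) (ae_of_all _ fun z => ?_) ?_
  · rw [Real.norm_of_nonneg (by positivity), one_mul]
    rcases eq_or_ne z 0 with rfl | hz
    · simp [Real.rpow_nonneg]
    · rw [← Real.rpow_natCast, ← Real.rpow_add (norm_pos_iff.2 hz)]
      exact (congrArg (‖z‖ ^ ·) (by push_cast; ring)).le
  · exact ((measurable_norm.pow_const 2).mul (measurable_norm.pow_const _)).aestronglyMeasurable

lemma exists_setIntegral_ball_lt (n : ℕ) (hn : 0 < n) {s c : ℝ} (hs : s < 1) (hc : 0 < c) :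
    ∃ r : ℝ, 0 < r ∧ r ≤ 1 ∧
      ∫ z in ball (0 : En n) r, ‖z‖ ^ 2 * ‖z‖ ^ (-((n : ℝ) + 2 * s)) < c := by
  have : Nonempty (Fin n) := ⟨⟨0, hn⟩⟩
  have h := tendsto_setIntegral_of_antitone (μ := (volume : Measure (En n)))
    (s := fun k : ℕ => ball (0 : En n) (1 / (k + 1)))
    (f := fun z => ‖z‖ ^ 2 * ‖z‖ ^ (-((n : ℝ) + 2 * s))) (fun _ => measurableSet_ball)
    (fun _ _ h => ball_subset_ball (Nat.one_div_le_one_div h))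
    ⟨0, integrableOn_sq_mul_norm_rpow_ball n hn hs _⟩
  have h0 : ⋂ k : ℕ, ball (0 : En n) (1 / (k + 1)) = {0} := by
    ext z
    simp only [mem_iInter, mem_ball_zero_iff, mem_singleton_iff]
    constructor
    · intro hz
      by_contra hne
      obtain ⟨k, hk⟩ := exists_nat_one_div_lt (norm_pos_iff.2 hne)
      exact absurd (hz k) hk.not_gt
    · rintro rfl k
      rw [norm_zero]
      positivity
  rw [h0, Measure.restrict_singleton] at h
  simp only [measure_singleton, zero_smul, integral_zero_measure] at h
  obtain ⟨k, hk⟩ := (h.eventually (gt_mem_nhds hc)).exists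
  refine ⟨1 / (k + 1), by positivity, ?_, hk⟩
  rw [div_le_one (by positivity)]
  linarith [k.cast_nonneg (α := ℝ)]

/-- Second-order Taylor estimate on a ball. -/
lemma abs_taylor_le {n : ℕ} {f : En n → ℝ} (hf : ContDiff ℝ 2 f) {x : En n} {ρ C : ℝ}
    (hC : ∀ y ∈ ball x ρ, ‖fderiv ℝ (fderiv ℝ f) y‖ ≤ C) {z : En n} (hz : ‖z‖ < ρ) :
    |f (x + z) - f x - fderiv ℝ f x z| ≤ C * ‖z‖ ^ 2 := by
  have hx : x ∈ ball x ρ := mem_ball_self ((norm_nonneg z).trans_lt hz)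
  have hC0 : 0 ≤ C := (norm_nonneg (fderiv ℝ (fderiv ℝ f) x)).trans (hC x hx)
  have hsub : closedBall x ‖z‖ ⊆ ball x ρ := closedBall_subset_ball hz
  have hf' : Differentiable ℝ (fderiv ℝ f) :=
    (hf.fderiv_right (m := 1) (by norm_num)).differentiable (by norm_num)
  have hxz : x ∈ closedBall x ‖z‖ := mem_closedBall_self (norm_nonneg z)
  have hyz : x + z ∈ closedBall x ‖z‖ := by simp
  have h1 : ∀ y ∈ closedBall x ‖z‖, ‖fderiv ℝ f y - fderiv ℝ f x‖ ≤ C * ‖z‖ := fun y hy =>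
    ((convex_closedBall x ‖z‖).norm_image_sub_le_of_norm_fderiv_le (fun w _ => hf' w)
      (fun w hw => hC w (hsub hw)) hxz hy).trans
      (mul_le_mul_of_nonneg_left (by simpa [dist_eq_norm] using hy) hC0)
  have h2 := (convex_closedBall x ‖z‖).norm_image_sub_le_of_norm_fderiv_le'
    (fun w _ => (hf.differentiable (by norm_num)) w) h1 hxz hyz
  rw [add_sub_cancel_left, Real.norm_eq_abs] at h2
  linarith

lemma exists_abs_taylor_le {n : ℕ} {f : En n → ℝ} (hf : ContDiff ℝ 2 f) (x : En n) :
    ∃ C, 0 ≤ C ∧ ∀ z : En n, ‖z‖ < 1 → |f (x + z) - f x - fderiv ℝ f x z| ≤ C * ‖z‖ ^ 2 := by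
  have hc : Continuous (fderiv ℝ (fderiv ℝ f)) :=
    (hf.fderiv_right (m := 1) (by norm_num)).continuous_fderiv (by norm_num)
  obtain ⟨C, hC⟩ := (isCompact_closedBall x 1).exists_bound_of_continuousOn
    (f := fderiv ℝ (fderiv ℝ f)) hc.continuousOn
  exact ⟨C, (norm_nonneg (fderiv ℝ (fderiv ℝ f) x)).trans (hC x (mem_closedBall_self zero_le_one)),
    fun z hz => abs_taylor_le hf (fun y hy => hC y (ball_subset_closedBall hy)) hz⟩

lemma setIntegral_eq_zero_of_odd {n : ℕ} {δ : ℝ} {g : En n → ℝ}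
    (hg : ∀ z, δ ≤ ‖z‖ → g (-z) = -g z) : ∫ z in {z : En n | δ ≤ ‖z‖}, g z = 0 := by
  rw [← integral_indicator (measurableSet_le_norm n δ)]
  set G := indicator {z : En n | δ ≤ ‖z‖} g with hG
  have h : ∀ z, G (-z) = -G z := by
    intro z
    by_cases hz : δ ≤ ‖z‖
    · rw [hG, indicator_of_mem (by simpa using hz), indicator_of_mem (by simpa using hz), hg z hz]
    · rw [hG, indicator_of_notMem (by simpa using hz), indicator_of_notMem (by simpa using hz),
        neg_zero]
  have h1 := integral_neg_eq_self G (volume : Measure (En n))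
  simp only [h, integral_neg] at h1
  linarith

lemma setIntegral_truncated_eq {n : ℕ} (K f : En n → ℝ) (hev : ∀ z, z ≠ 0 → K z = K (-z))
    (x : En n) {δ : ℝ} (hδ : 0 < δ) :
    ∫ y in {y : En n | δ ≤ dist y x}, (f x - f y) * K (x - y) =
      ∫ z in {z : En n | δ ≤ ‖z‖}, (f x - f (x + z)) * K z := by
  rw [← integral_indicator (measurableSet_le_norm n δ), ← integral_indicator
    (s := {y : En n | δ ≤ dist y x})
    (measurableSet_le measurable_const (measurable_id.dist measurable_const)),
    ← integral_add_left_eq_self _ x]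
  congr 1
  ext z
  by_cases hz : δ ≤ ‖z‖
  · rw [indicator_of_mem (by simpa [dist_eq_norm] using hz), indicator_of_mem (by simpa using hz),
      hev z (norm_pos_iff.1 (hδ.trans_le hz)), sub_add_cancel_left]
  · rw [indicator_of_notMem (by simpa [dist_eq_norm] using hz),
      indicator_of_notMem (by simpa using hz)]

lemma integrableOn_mul_of_bounded {n : ℕ} {K g : En n → ℝ} {δ B : ℝ}
    (hK : IntegrableOn K {z : En n | δ ≤ ‖z‖}) (hg : Measurable g)
    (hB : ∀ z, δ ≤ ‖z‖ → |g z| ≤ B) :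
    IntegrableOn (fun z => g z * K z) {z : En n | δ ≤ ‖z‖} :=
  Integrable.bdd_mul hK hg.aestronglyMeasurable
    ((ae_restrict_iff' (measurableSet_le_norm n δ)).2 (ae_of_all _ hB))

/-- The principal value defining `opK` converges for bounded `C²` functions. -/
lemma tendsto_opK {n : ℕ} {K f : En n → ℝ} (hev : ∀ z, z ≠ 0 → K z = K (-z))
    (hKm : AEStronglyMeasurable K)
    (hfar : ∀ δ, 0 < δ → IntegrableOn K {z : En n | δ ≤ ‖z‖})
    (hnear : IntegrableOn (fun z => ‖z‖ ^ 2 * K z) (ball (0 : En n) 1))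
    (hf : ContDiff ℝ 2 f) {B : ℝ} (hB : ∀ y, |f y| ≤ B) (x : En n) :
    Tendsto (fun δ => ∫ z in {z : En n | δ ≤ ‖z‖}, (f x - f (x + z)) * K z)
      (nhdsWithin 0 (Ioi 0)) (nhds (opK n K f x)) := by
  obtain ⟨C, hC0, hC⟩ := exists_abs_taylor_le hf x
  set ℓ : En n → ℝ := indicator (ball 0 1) fun z => fderiv ℝ f x z with hℓ
  have hℓm : Measurable ℓ := (fderiv ℝ f x).continuous.measurable.indicator measurableSet_ball
  have hℓB : ∀ z, |ℓ z| ≤ ‖fderiv ℝ f x‖ := by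
    intro z
    by_cases hz : z ∈ ball (0 : En n) 1
    · rw [hℓ, indicator_of_mem hz]
      exact ((fderiv ℝ f x).le_opNorm z).trans
        (mul_le_of_le_one_right (norm_nonneg _) (mem_ball_zero_iff.1 hz).le)
    · rw [hℓ, indicator_of_notMem hz, abs_zero]
      exact norm_nonneg _
  have hfm : Measurable fun z => f x - f (x + z) := by
    have := hf.continuous
    exact Continuous.measurable (by fun_prop)
  have hfB : ∀ z, |f x - f (x + z)| ≤ B + B := fun z =>
    (abs_sub _ _).trans (add_le_add (hB _) (hB _))
  set g : En n → ℝ := fun z => (f x - f (x + z) + ℓ z) * K z with hg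
  have hgi : Integrable g := by
    have hu : ball (0 : En n) 1 ∪ {z | 1 ≤ ‖z‖} = univ := by
      ext z
      simpa using lt_or_ge ‖z‖ 1
    rw [← integrableOn_univ, ← hu]
    have hi : IntegrableOn g {z | 1 ≤ ‖z‖} :=
      integrableOn_mul_of_bounded (hfar 1 one_pos) (hfm.add hℓm)
        fun z _ => (abs_add_le _ _).trans (add_le_add (hfB z) (hℓB z))
    refine IntegrableOn.union ?_ hi
    refine Integrable.mono' (hnear.norm.const_mul C) ?_ ?_
    · exact (hfm.add hℓm).aestronglyMeasurable.mul hKm.restrict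
    · refine (ae_restrict_iff' measurableSet_ball).2 (ae_of_all _ fun z hz => ?_)
      simp only [hg, norm_mul, hℓ, indicator_of_mem hz, norm_pow, norm_norm, ← mul_assoc]
      refine mul_le_mul_of_nonneg_right ?_ (norm_nonneg _)
      have := hC z (mem_ball_zero_iff.1 hz)
      rwa [← abs_neg, show -(f (x + z) - f x - fderiv ℝ f x z) =
        f x - f (x + z) + fderiv ℝ f x z by ring] at this
  have hlim : Tendsto (fun δ => ∫ z in {z : En n | δ ≤ ‖z‖}, g z)
      (nhdsWithin 0 (Ioi 0)) (nhds (∫ z, g z)) := by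
    simp_rw [← integral_indicator (measurableSet_le_norm n _)]
    refine tendsto_integral_filter_of_dominated_convergence (fun z => ‖g z‖)
      (Eventually.of_forall fun δ =>
        (hgi.indicator (measurableSet_le_norm n δ)).aestronglyMeasurable)
      (Eventually.of_forall fun δ => ae_of_all _ fun z => norm_indicator_le_norm_self _ _)
      hgi.norm (ae_of_all _ fun z => ?_)
    rcases eq_or_ne z 0 with rfl | hz
    · have h0 : g 0 = 0 := by simp [hg, hℓ]
      refine tendsto_const_nhds.congr fun δ => ?_
      by_cases h : (0 : En n) ∈ {z : En n | δ ≤ ‖z‖}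
      · rw [indicator_of_mem h]
      · rw [indicator_of_notMem h, h0]
    · refine tendsto_const_nhds.congr' ?_
      have hev : ∀ᶠ δ in nhdsWithin (0 : ℝ) (Ioi 0), δ < ‖z‖ :=
        nhdsWithin_le_nhds (gt_mem_nhds (norm_pos_iff.2 hz))
      filter_upwards [hev] with δ hδ
      rw [indicator_of_mem (show z ∈ {z : En n | δ ≤ ‖z‖} from hδ.le)]
  have heq : ∀ δ, 0 < δ → ∫ z in {z : En n | δ ≤ ‖z‖}, (f x - f (x + z)) * K z =
      ∫ z in {z : En n | δ ≤ ‖z‖}, g z := by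
    intro δ hδ
    have hodd : ∫ z in {z : En n | δ ≤ ‖z‖}, ℓ z * K z = 0 := by
      refine setIntegral_eq_zero_of_odd fun z hz => ?_
      rw [← hev z (norm_pos_iff.1 (hδ.trans_le hz)), ← neg_mul]
      congr 1
      by_cases hz : z ∈ ball (0 : En n) 1
      · rw [hℓ, indicator_of_mem hz, indicator_of_mem (by simpa using hz), map_neg]
      · rw [hℓ, indicator_of_notMem hz, indicator_of_notMem (by simpa using hz), neg_zero]
    simp only [hg, add_mul]
    rw [integral_add (integrableOn_mul_of_bounded (hfar δ hδ) hfm fun z _ => hfB z)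
      (integrableOn_mul_of_bounded (hfar δ hδ) hℓm fun z _ => hℓB z), hodd, add_zero]
  have hpos : ∀ᶠ δ in nhdsWithin (0 : ℝ) (Ioi 0), 0 < δ := self_mem_nhdsWithin
  have hlim' := hlim.congr' (hpos.mono fun δ hδ => (heq δ hδ).symm)
  have hpv := hlim'.congr' (hpos.mono fun δ hδ => (setIntegral_truncated_eq K f hev x hδ).symm)
  rwa [opK, pvAt, hpv.limUnder_eq]

lemma abs_sq_mul_sq_add_le {a b c M B σ : ℝ} (hσ : 0 ≤ σ) (ha : |a| ≤ M) (hb : |b| ≤ B)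
    (hc : |c| ≤ B) : |a ^ 2 * b ^ 2 + σ * c ^ 2| ≤ M ^ 2 * B ^ 2 + σ * B ^ 2 := by
  have h1 := sq_le_sq' (neg_le_of_abs_le ha) (le_of_abs_le ha)
  have h2 := sq_le_sq' (neg_le_of_abs_le hb) (le_of_abs_le hb)
  have h3 := sq_le_sq' (neg_le_of_abs_le hc) (le_of_abs_le hc)
  rw [abs_of_nonneg (by positivity)]
  gcongr

lemma near_pointwise_bound {a b V W L M Λ t : ℝ} (ha : |a| ≤ M) (hV : |V| ≤ Λ) (hW : |W| ≤ Λ)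
    (hab : |a - b| ≤ M * t) (hL : |b - a - L| ≤ M * t ^ 2) :
    2 * a ^ 2 * V * W - a ^ 2 * V ^ 2 - b ^ 2 * W ^ 2 ≤
      -2 * a * V ^ 2 * L + 6 * M ^ 2 * Λ ^ 2 * t ^ 2 := by
  have hM : 0 ≤ M := (abs_nonneg a).trans ha
  have hΛ : 0 ≤ Λ := (abs_nonneg V).trans hV
  have h1 : (a - b) ^ 2 * (W + V) ^ 2 ≤ (M * t) ^ 2 * (2 * Λ) ^ 2 := by
    refine mul_le_mul (sq_le_sq' (neg_le_of_abs_le hab) (le_of_abs_le hab)) ?_ (sq_nonneg _)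
      (sq_nonneg _)
    rw [abs_le] at hV hW
    exact sq_le_sq' (by linarith) (by linarith)
  have hV2 : V ^ 2 ≤ Λ ^ 2 := sq_le_sq' (neg_le_of_abs_le hV) (le_of_abs_le hV)
  have h2 : -(a * V ^ 2 * (b - a - L)) ≤ M * Λ ^ 2 * (M * t ^ 2) := by
    refine (neg_le_abs _).trans ?_
    rw [abs_mul, abs_mul, abs_of_nonneg (sq_nonneg V)]
    exact mul_le_mul (mul_le_mul ha hV2 (sq_nonneg _) hM) hL (abs_nonneg _) (by positivity)
  nlinarith [sq_nonneg (a * (V - W) + (a - b) * (W + V)), sq_nonneg ((a - b) * W)]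

lemma far_pointwise_bound {a V d h k σ M Λ D : ℝ} (hσ : 0 < σ) (hk : 0 ≤ k)
    (ha : |a| ≤ M) (hV : |V| ≤ Λ) (hh : |h| ≤ D * k) :
    2 * a ^ 2 * V * (d * h) ≤ (σ * d ^ 2 + M ^ 4 * Λ ^ 2 * D ^ 2 / σ) * k := by
  have hM : 0 ≤ M := (abs_nonneg a).trans ha
  have hΛ : 0 ≤ Λ := (abs_nonneg V).trans hV
  have ha2 : a ^ 2 ≤ M ^ 2 := sq_le_sq' (neg_le_of_abs_le ha) (le_of_abs_le ha)
  have h1 : 2 * a ^ 2 * V * (d * h) ≤ 2 * M ^ 2 * Λ * (|d| * (D * k)) := by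
    refine (le_abs_self _).trans ?_
    rw [abs_mul, abs_mul, abs_mul, abs_mul, abs_of_nonneg (sq_nonneg a), abs_two]
    gcongr
  have h2 : 2 * (M ^ 2 * Λ * D) * |d| ≤ σ * d ^ 2 + M ^ 4 * Λ ^ 2 * D ^ 2 / σ := by
    have h3 : σ * d ^ 2 + M ^ 4 * Λ ^ 2 * D ^ 2 / σ - 2 * (M ^ 2 * Λ * D) * |d| =
        (σ * |d| - M ^ 2 * Λ * D) ^ 2 / σ := by
      rw [← sq_abs d]
      field_simp
      ring
    have h4 : 0 ≤ (σ * |d| - M ^ 2 * Λ * D) ^ 2 / σ := by positivity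
    linarith
  calc _ ≤ 2 * M ^ 2 * Λ * (|d| * (D * k)) := h1
    _ = 2 * (M ^ 2 * Λ * D) * |d| * k := by ring
    _ ≤ _ := mul_le_mul_of_nonneg_right h2 hk

/-- The part of the kernel `K` away from the origin. -/
def farKernel (n : ℕ) (χ : ContDiffBump (0 : En n)) (K : En n → ℝ) (z : En n) : ℝ :=
  (1 - χ z) * K z

section FarKernel

variable {n : ℕ} {χ : ContDiffBump (0 : En n)} {K : En n → ℝ}

lemma farKernel_eq_zero {z : En n} (hz : ‖z‖ ≤ χ.rIn) : farKernel n χ K z = 0 := by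
  rw [farKernel, χ.one_of_mem_closedBall (by simpa using hz), sub_self, zero_mul]

lemma hasFDerivAt_farKernel_of_lt {z : En n} (hz : ‖z‖ < χ.rIn) :
    HasFDerivAt (farKernel n χ K) (0 : En n →L[ℝ] ℝ) z := by
  refine (hasFDerivAt_const (0 : ℝ) z).congr_of_eventuallyEq ?_
  filter_upwards [isOpen_ball.mem_nhds (mem_ball_zero_iff.2 hz)] with y hy
  exact farKernel_eq_zero (mem_ball_zero_iff.1 hy).le

lemma hasFDerivAt_farKernel {z : En n} (hK : DifferentiableAt ℝ K z) :
    HasFDerivAt (farKernel n χ K) ((1 - χ z) • fderiv ℝ K z + K z • (-fderiv ℝ χ z)) z :=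
  (((χ.contDiff (n := 1)).differentiable (by norm_num) z).hasFDerivAt.const_sub 1).mul
    hK.hasFDerivAt

lemma differentiable_farKernel (hK : ∀ z, z ≠ 0 → DifferentiableAt ℝ K z) :
    Differentiable ℝ (farKernel n χ K) := by
  intro z
  rcases eq_or_ne z 0 with rfl | hz
  · exact (hasFDerivAt_farKernel_of_lt (by simpa using χ.rIn_pos)).differentiableAt
  · exact (hasFDerivAt_farKernel (hK z hz)).differentiableAt

lemma abs_fderiv_farKernel_le {C₃ D : ℝ} (hK : ∀ z, z ≠ 0 → DifferentiableAt ℝ K z)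
    (hK0 : ∀ z, z ≠ 0 → 0 ≤ K z) (hC₃ : ∀ z, z ≠ 0 → ‖z‖ * ‖fderiv ℝ K z‖ ≤ C₃ * K z)
    (hD : ∀ z, ‖fderiv ℝ χ z‖ ≤ D) {e : En n} (he : ‖e‖ = 1) {z : En n} (hz : χ.rIn ≤ ‖z‖) :
    |fderiv ℝ (farKernel n χ K) z e| ≤ (C₃ / χ.rIn + D) * K z := by
  have hz0 : z ≠ 0 := norm_pos_iff.1 (χ.rIn_pos.trans_le hz)
  have hd : ‖fderiv ℝ K z‖ ≤ C₃ / χ.rIn * K z := by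
    rw [div_mul_eq_mul_div, le_div_iff₀ χ.rIn_pos, mul_comm]
    exact (mul_le_mul_of_nonneg_right hz (norm_nonneg _)).trans (hC₃ z hz0)
  rw [(hasFDerivAt_farKernel (hK z hz0)).fderiv]
  refine (((1 - χ z) • fderiv ℝ K z + K z • (-fderiv ℝ χ z)).le_opNorm e).trans ?_
  rw [he, mul_one, add_mul]
  refine (norm_add_le _ _).trans (add_le_add ?_ ?_)
  · rw [norm_smul, Real.norm_of_nonneg (by linarith [χ.le_one (x := z)])]
    exact (mul_le_of_le_one_left (norm_nonneg _) (by linarith [χ.nonneg (x := z)])).trans hd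
  · rw [norm_smul, norm_neg, Real.norm_of_nonneg (hK0 z hz0), mul_comm]
    exact mul_le_mul_of_nonneg_right (hD z) (hK0 z hz0)

lemma integrableOn_mul_farKernel {g : En n → ℝ} {B δ : ℝ}
    (hfar : IntegrableOn K {z : En n | δ ≤ ‖z‖}) (hg : Measurable g) (hB : ∀ z, |g z| ≤ B) :
    IntegrableOn (fun z => g z * farKernel n χ K z) {z : En n | δ ≤ ‖z‖} := by
  have h := integrableOn_mul_of_bounded (g := fun z => g z * (1 - χ z)) (B := B) hfar
    (hg.mul (measurable_const.sub χ.continuous.measurable)) (fun z _ => ?_)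
  · simpa only [farKernel, mul_assoc] using h
  · have h0 := χ.nonneg (x := z)
    have h1 := χ.le_one (x := z)
    rw [abs_mul, abs_of_nonneg (by linarith : 0 ≤ 1 - χ z)]
    exact (mul_le_of_le_one_right (abs_nonneg _) (by linarith)).trans (hB z)

lemma integrableOn_mul_fderiv_farKernel {g : En n → ℝ} {B D δ : ℝ} {e : En n}
    (hfar : IntegrableOn K {z : En n | δ ≤ ‖z‖})
    (hD : ∀ z, χ.rIn ≤ ‖z‖ → |fderiv ℝ (farKernel n χ K) z e| ≤ D * K z)
    (hg : Measurable g) (hB : ∀ z, |g z| ≤ B) :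
    IntegrableOn (fun z => g z * fderiv ℝ (farKernel n χ K) z e) {z : En n | δ ≤ ‖z‖} := by
  refine Integrable.bdd_mul (c := B) ?_ hg.aestronglyMeasurable (ae_of_all _ hB)
  refine Integrable.mono' (hfar.norm.const_mul |D|)
    (measurable_fderiv_apply_const ℝ _ e).aestronglyMeasurable (ae_of_all _ fun z => ?_)
  rcases lt_or_ge ‖z‖ χ.rIn with hz | hz
  · rw [(hasFDerivAt_farKernel_of_lt hz).fderiv, zero_apply, norm_zero]
    positivity
  · refine (hD z hz).trans ?_
    rw [Real.norm_eq_abs, ← abs_mul]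
    exact le_abs_self _

/-- Integration by parts against the far part of the kernel. -/
lemma setIntegral_dd_mul_farKernel {u : En n → ℝ} {B D δ : ℝ} {e : En n}
    (hfar : IntegrableOn K {z : En n | δ ≤ ‖z‖}) (hδ : δ ≤ χ.rIn)
    (hK : ∀ z, z ≠ 0 → DifferentiableAt ℝ K z)
    (hD : ∀ z, χ.rIn ≤ ‖z‖ → |fderiv ℝ (farKernel n χ K) z e| ≤ D * K z)
    (hu : ContDiff ℝ 1 u) (hB : ∀ y, |u y| ≤ B) (hB' : ∀ y, |dd n e u y| ≤ B) (x : En n) :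
    ∫ z in {z : En n | δ ≤ ‖z‖}, dd n e u (x + z) * farKernel n χ K z =
      ∫ z in {z : En n | δ ≤ ‖z‖}, (u x - u (x + z)) * fderiv ℝ (farKernel n χ K) z e := by
  set f : En n → ℝ := fun z => u (x + z) - u x with hf
  have hud : Differentiable ℝ u := hu.differentiable (by norm_num)
  have huc := hu.continuous
  have hfm : Measurable f := Continuous.measurable (by fun_prop)
  have hfB : ∀ z, |f z| ≤ B + B := fun z => (abs_sub _ _).trans (add_le_add (hB _) (hB _))
  have hfd : ∀ z, fderiv ℝ f z e = dd n e u (x + z) := by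
    intro z
    rw [hf, fderiv_sub_const, fderiv_comp_add_left, dd]
  have hfdm : Measurable fun z => fderiv ℝ f z e := measurable_fderiv_apply_const ℝ f e
  have hw0 : ∀ z, z ∉ {z : En n | δ ≤ ‖z‖} → farKernel n χ K z = 0 := fun z hz =>
    farKernel_eq_zero ((not_le.1 hz).le.trans hδ)
  have hw0' : ∀ z, z ∉ {z : En n | δ ≤ ‖z‖} → fderiv ℝ (farKernel n χ K) z e = 0 := by
    intro z hz
    rw [(hasFDerivAt_farKernel_of_lt ((not_le.1 hz).trans_le hδ)).fderiv,
      zero_apply]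
  have extend : ∀ g h : En n → ℝ, (∀ z, z ∉ {z : En n | δ ≤ ‖z‖} → h z = 0) →
      IntegrableOn (fun z => g z * h z) {z : En n | δ ≤ ‖z‖} →
      Integrable (fun z => g z * h z) := fun g h h0 hi =>
    hi.integrable_of_forall_notMem_eq_zero fun z hz => by rw [h0 z hz, mul_zero]
  have hibp := integral_mul_fderiv_eq_neg_fderiv_mul_of_integrable
    (f := f) (g := farKernel n χ K) (v := e) (μ := volume)
    (extend _ _ hw0 (integrableOn_mul_farKernel hfar hfdm fun z => by rw [hfd]; exact hB' _))
    (extend _ _ hw0' (integrableOn_mul_fderiv_farKernel hfar hD hfm hfB))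
    (extend _ _ hw0 (integrableOn_mul_farKernel hfar hfm hfB))
    (fun z _ => (hud.comp (differentiable_id.const_add x)).sub_const _ z)
    (fun z _ => differentiable_farKernel hK z)
  rw [setIntegral_eq_integral_of_forall_compl_eq_zero fun z hz => by rw [hw0 z hz, mul_zero],
    setIntegral_eq_integral_of_forall_compl_eq_zero fun z hz => by rw [hw0' z hz, mul_zero]]
  simp only [hfd] at hibp
  rw [← neg_eq_iff_eq_neg, ← integral_neg] at hibp
  rw [← hibp]
  simp only [hf, ← neg_mul, neg_sub]

end FarKernel

lemma contDiff_dd {n : ℕ} {u : En n → ℝ} (hu : ContDiff ℝ (⊤ : ℕ∞) u) (e : En n) :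
    ContDiff ℝ (⊤ : ℕ∞) (dd n e u) :=
  (hu.fderiv_right (m := (⊤ : ℕ∞)) (by exact_mod_cast le_top)).clm_apply contDiff_const

/-- The key inequality for the truncated operators, with an explicit remainder. -/
lemma truncated_key_inequality {n : ℕ} {χ : ContDiffBump (0 : En n)} {K u η : En n → ℝ}
    {B M Λ D σ δ : ℝ} {e x : En n}
    (hev : ∀ z, z ≠ 0 → K z = K (-z)) (hK0 : ∀ z, z ≠ 0 → 0 ≤ K z)
    (hfar : ∀ δ, 0 < δ → IntegrableOn K {z : En n | δ ≤ ‖z‖})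
    (hnear : IntegrableOn (fun z => ‖z‖ ^ 2 * K z) (ball (0 : En n) 1))
    (hK : ∀ z, z ≠ 0 → DifferentiableAt ℝ K z) (hχ : χ.rOut ≤ 1)
    (hD : ∀ z, χ.rIn ≤ ‖z‖ → |fderiv ℝ (farKernel n χ K) z e| ≤ D * K z)
    (hu : ContDiff ℝ (⊤ : ℕ∞) u) (hB : ∀ y, |u y| ≤ B) (hB' : ∀ y, |dd n e u y| ≤ B)
    (hη : ContDiff ℝ (⊤ : ℕ∞) η) (hM : C2BddBy n η M)
    (hΛ : ∀ y ∈ ball x 1, |dd n e u y| ≤ Λ) (hσ : 0 < σ) (hδ : 0 < δ) (hδχ : δ ≤ χ.rIn) :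
    ∫ z in {z : En n | δ ≤ ‖z‖}, ((η x ^ 2 * dd n e u x ^ 2 + σ * u x ^ 2) -
        (η (x + z) ^ 2 * dd n e u (x + z) ^ 2 + σ * u (x + z) ^ 2)) * K z ≤
      2 * η x ^ 2 * dd n e u x *
          (∫ z in {z : En n | δ ≤ ‖z‖}, (dd n e u x - dd n e u (x + z)) * K z) +
        2 * σ * u x * (∫ z in {z : En n | δ ≤ ‖z‖}, (u x - u (x + z)) * K z) +
        (6 * M ^ 2 * Λ ^ 2 * (∫ z in ball (0 : En n) χ.rOut, ‖z‖ ^ 2 * K z) +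
          M ^ 4 * Λ ^ 2 * D ^ 2 / σ * ∫ z in {z : En n | χ.rIn ≤ ‖z‖}, K z) := by
  have hM0 : 0 ≤ M := (abs_nonneg _).trans (hM x).1
  have hVΛ := hΛ x (mem_ball_self one_pos)
  set v := dd n e u with hv
  have hvs : ContDiff ℝ (⊤ : ℕ∞) v := contDiff_dd hu e
  have huc := hu.continuous
  have hvc := hvs.continuous
  have hηc := hη.continuous
  have hχc := χ.continuous
  set S : Set (En n) := {z : En n | δ ≤ ‖z‖} with hS
  have hSm : MeasurableSet S := measurableSet_le_norm n δ
  have hKS : IntegrableOn K S := hfar δ hδ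
  set ℓ := fderiv ℝ η x with hℓ
  set w' : En n → ℝ := fun z => fderiv ℝ (farKernel n χ K) z e with hw'
  have hsub : ball (0 : En n) χ.rOut ⊆ ball 0 1 := ball_subset_ball hχ
  have hdiffB : ∀ {p q r : ℝ}, |p| ≤ r → |q| ≤ r → |p - q| ≤ r + r := fun hp hq =>
    (abs_sub _ _).trans (add_le_add hp hq)
  have hnear0 : ∀ z : En n, 0 ≤ ‖z‖ ^ 2 * K z := by
    intro z
    rcases eq_or_ne z 0 with rfl | hz
    · simp
    · exact mul_nonneg (sq_nonneg _) (hK0 z hz)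
  -- integrability of all the pieces
  have iA : IntegrableOn (fun z => ((η x ^ 2 * v x ^ 2 + σ * u x ^ 2) -
      (η (x + z) ^ 2 * v (x + z) ^ 2 + σ * u (x + z) ^ 2)) * K z) S := by
    have hb : ∀ y, |η y ^ 2 * v y ^ 2 + σ * u y ^ 2| ≤ M ^ 2 * B ^ 2 + σ * B ^ 2 :=
      fun y => abs_sq_mul_sq_add_le hσ.le (hM y).1 (hB' y) (hB y)
    exact integrableOn_mul_of_bounded hKS (Continuous.measurable (by fun_prop))
      fun z _ => hdiffB (hb x) (hb (x + z))
  have iV : IntegrableOn (fun z => (v x - v (x + z)) * K z) S :=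
    integrableOn_mul_of_bounded hKS (Continuous.measurable (by fun_prop))
      fun z _ => hdiffB (hB' x) (hB' (x + z))
  have iU : IntegrableOn (fun z => (u x - u (x + z)) * K z) S :=
    integrableOn_mul_of_bounded hKS (Continuous.measurable (by fun_prop))
      fun z _ => hdiffB (hB x) (hB (x + z))
  have iO : IntegrableOn (fun z => (χ z * ℓ z) * K z) S := by
    refine integrableOn_mul_of_bounded (B := ‖ℓ‖) hKS
      (Continuous.measurable (by fun_prop)) fun z _ => ?_
    rw [abs_mul, abs_of_nonneg χ.nonneg]
    rcases lt_or_ge ‖z‖ χ.rOut with hz | hz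
    · refine (mul_le_of_le_one_left (abs_nonneg _) χ.le_one).trans ((ℓ.le_opNorm z).trans ?_)
      exact mul_le_of_le_one_right (norm_nonneg _) (hz.le.trans hχ)
    · rw [χ.zero_of_le_dist (by simpa using hz), zero_mul]
      exact norm_nonneg _
  have iN : Integrable ((ball (0 : En n) χ.rOut).indicator fun z => ‖z‖ ^ 2 * K z) :=
    (integrable_indicator_iff measurableSet_ball).2 (hnear.mono_set hsub)
  have iG : IntegrableOn (fun z => v (x + z) * farKernel n χ K z) S :=
    integrableOn_mul_farKernel hKS (Continuous.measurable (by fun_prop)) fun z => hB' _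
  have iH : IntegrableOn (fun z => (u x - u (x + z)) * w' z) S :=
    integrableOn_mul_fderiv_farKernel hKS hD (Continuous.measurable (by fun_prop))
      fun z => hdiffB (hB x) (hB (x + z))
  have iF : Integrable ({z : En n | χ.rIn ≤ ‖z‖}.indicator K) :=
    (integrable_indicator_iff (measurableSet_le_norm n _)).2 (hfar _ χ.rIn_pos)
  -- values of the auxiliary integrals
  have eO : ∫ z in S, (χ z * ℓ z) * K z = 0 := by
    refine setIntegral_eq_zero_of_odd fun z hz => ?_
    rw [← hev z (norm_pos_iff.1 (hδ.trans_le hz)), χ.neg, map_neg]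
    ring
  have eG : ∫ z in S, v (x + z) * farKernel n χ K z = ∫ z in S, (u x - u (x + z)) * w' z :=
    setIntegral_dd_mul_farKernel hKS hδχ hK hD (contDiff_infty.1 hu 1) hB hB' x
  have eN : ∫ z in S, (ball (0 : En n) χ.rOut).indicator (fun z => ‖z‖ ^ 2 * K z) z ≤
      ∫ z in ball (0 : En n) χ.rOut, ‖z‖ ^ 2 * K z := by
    rw [← integral_indicator measurableSet_ball]
    exact setIntegral_le_integral iN
      (ae_of_all _ fun z => indicator_nonneg (fun z _ => hnear0 z) z)
  have eF : ∫ z in S, {z : En n | χ.rIn ≤ ‖z‖}.indicator K z ≤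
      ∫ z in {z : En n | χ.rIn ≤ ‖z‖}, K z := by
    rw [← integral_indicator (measurableSet_le_norm n χ.rIn)]
    exact setIntegral_le_integral iF (ae_of_all _ fun z => indicator_nonneg
      (fun z hz => hK0 z (norm_pos_iff.1 (χ.rIn_pos.trans_le hz))) z)
  -- the pointwise inequality
  have hpt : ∀ z ∈ S, ((η x ^ 2 * v x ^ 2 + σ * u x ^ 2) -
      (η (x + z) ^ 2 * v (x + z) ^ 2 + σ * u (x + z) ^ 2)) * K z ≤
      2 * η x ^ 2 * v x * ((v x - v (x + z)) * K z) + 2 * σ * u x * ((u x - u (x + z)) * K z) +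
      (-2 * η x * v x ^ 2) * ((χ z * ℓ z) * K z) +
      6 * M ^ 2 * Λ ^ 2 * (ball (0 : En n) χ.rOut).indicator (fun z => ‖z‖ ^ 2 * K z) z +
      2 * η x ^ 2 * v x * (v (x + z) * farKernel n χ K z) +
      (-(2 * η x ^ 2 * v x)) * ((u x - u (x + z)) * w' z) +
      M ^ 4 * Λ ^ 2 * D ^ 2 / σ * {z : En n | χ.rIn ≤ ‖z‖}.indicator K z := by
    intro z hz
    have hk : 0 ≤ K z := hK0 z (norm_pos_iff.1 (hδ.trans_le hz))
    have hnearz : χ z * (2 * η x ^ 2 * v x * v (x + z) - η x ^ 2 * v x ^ 2 -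
        η (x + z) ^ 2 * v (x + z) ^ 2) * K z ≤
        (-2 * η x * v x ^ 2) * ((χ z * ℓ z) * K z) +
        6 * M ^ 2 * Λ ^ 2 * (ball (0 : En n) χ.rOut).indicator (fun z => ‖z‖ ^ 2 * K z) z := by
      rcases lt_or_ge ‖z‖ χ.rOut with hzr | hzr
      · rw [indicator_of_mem (by simpa using hzr)]
        have hab : |η x - η (x + z)| ≤ M * ‖z‖ := by
          have := convex_univ.norm_image_sub_le_of_norm_fderiv_le
            (fun y _ => (hη.differentiable (by simp)) y) (fun y _ => (hM y).2.1)
            (mem_univ (x + z)) (mem_univ x)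
          simpa using this
        have hL := abs_taylor_le (contDiff_infty.1 hη 2) (x := x)
          (ρ := 1) (fun y _ => (hM y).2.2) (hzr.trans_le hχ)
        have hp := near_pointwise_bound (hM x).1 hVΛ
          (hΛ (x + z) (by simpa using hzr.trans_le hχ)) hab hL
        have h1 := mul_le_mul_of_nonneg_right (mul_le_mul_of_nonneg_left hp (χ.nonneg (x := z))) hk
        have h2 : χ z * (6 * M ^ 2 * Λ ^ 2 * (‖z‖ ^ 2 * K z)) ≤
            6 * M ^ 2 * Λ ^ 2 * (‖z‖ ^ 2 * K z) :=
          mul_le_of_le_one_left (mul_nonneg (by positivity) (hnear0 z)) χ.le_one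
        linarith
      · rw [indicator_of_notMem (by simpa using hzr), χ.zero_of_le_dist (by simpa using hzr)]
        simp
    have hfarz : 2 * η x ^ 2 * v x * ((u x - u (x + z)) * w' z) ≤
        σ * (u x - u (x + z)) ^ 2 * K z +
        M ^ 4 * Λ ^ 2 * D ^ 2 / σ * {z : En n | χ.rIn ≤ ‖z‖}.indicator K z := by
      rcases lt_or_ge ‖z‖ χ.rIn with hzr | hzr
      · rw [hw', indicator_of_notMem (by simpa using hzr)]
        simp only [(hasFDerivAt_farKernel_of_lt hzr).fderiv, zero_apply, mul_zero, add_zero]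
        positivity
      · rw [indicator_of_mem (show z ∈ {z : En n | χ.rIn ≤ ‖z‖} from hzr), ← add_mul]
        exact far_pointwise_bound hσ hk (hM x).1 hVΛ (hD z hzr)
    have hcut : (1 - χ z) * (2 * η x ^ 2 * v x * v (x + z) - η x ^ 2 * v x ^ 2 -
        η (x + z) ^ 2 * v (x + z) ^ 2) * K z ≤
        2 * η x ^ 2 * v x * (v (x + z) * farKernel n χ K z) := by
      have h1 : 0 ≤ (1 - χ z) * (η x ^ 2 * v x ^ 2 + η (x + z) ^ 2 * v (x + z) ^ 2) * K z :=
        mul_nonneg (mul_nonneg (by linarith [χ.le_one (x := z)]) (by positivity)) hk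
      rw [farKernel]
      linarith
    linarith
  have j2 := (iV.const_mul (2 * η x ^ 2 * v x)).add (iU.const_mul (2 * σ * u x))
  have j3 := j2.add (iO.const_mul (-2 * η x * v x ^ 2))
  have j4 := j3.add (iN.integrableOn (s := S) |>.const_mul (6 * M ^ 2 * Λ ^ 2))
  have j5 := j4.add (iG.const_mul (2 * η x ^ 2 * v x))
  have j6 := j5.add (iH.const_mul (-(2 * η x ^ 2 * v x)))
  have j7 := iF.integrableOn (s := S) |>.const_mul (M ^ 4 * Λ ^ 2 * D ^ 2 / σ)
  have hint := setIntegral_mono_on iA (j6.add j7) hSm hpt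
  rw [integral_add' j6 j7, integral_add' j5 (iH.const_mul _), integral_add' j4 (iG.const_mul _),
    integral_add' j3 (iN.integrableOn.const_mul _), integral_add' j2 (iO.const_mul _),
    integral_add' (iV.const_mul _) (iU.const_mul _)] at hint
  simp only [integral_const_mul] at hint
  rw [eO, eG] at hint
  have h1 := mul_le_mul_of_nonneg_left eN (show 0 ≤ 6 * M ^ 2 * Λ ^ 2 by positivity)
  have h2 := mul_le_mul_of_nonneg_left eF (show 0 ≤ M ^ 4 * Λ ^ 2 * D ^ 2 / σ by positivity)
  linarith

section Kernel

variable {n : ℕ} {s C₁ C₂ C₃ : ℝ} {K : En n → ℝ}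

lemma kernelDerivBdd.differentiableAt (h : kernelDerivBdd n C₃ K) {z : En n} (hz : z ≠ 0) :
    DifferentiableAt ℝ K z :=
  (h.1.contDiffAt (isOpen_ne.mem_nhds hz)).differentiableAt (by norm_num)

lemma kernelDerivBdd.aestronglyMeasurable (hn : 0 < n) (h : kernelDerivBdd n C₃ K) :
    AEStronglyMeasurable K := by
  have : Nonempty (Fin n) := ⟨⟨0, hn⟩⟩
  rw [← restrict_compl_singleton (μ := (volume : Measure (En n))) 0]
  exact h.1.continuousOn.aestronglyMeasurable (measurableSet_singleton 0).compl

lemma evenPowKernel.nonneg (hs : s ∈ Ioo (0 : ℝ) 1) (hC₁ : 0 < C₁)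
    (h : evenPowKernel n s C₁ C₂ K) {z : En n} (hz : z ≠ 0) : 0 ≤ K z := by
  have h1 : 0 < 1 - s := by linarith [hs.2]
  have h0 := hs.1
  exact le_trans (by positivity) (h.2 z hz).1

lemma evenPowKernel.norm_le (hs : s ∈ Ioo (0 : ℝ) 1) (hC₁ : 0 < C₁)
    (h : evenPowKernel n s C₁ C₂ K) {z : En n} (hz : z ≠ 0) :
    ‖K z‖ ≤ C₂ * (s * (1 - s)) * ‖z‖ ^ (-((n : ℝ) + 2 * s)) := by
  rw [Real.norm_of_nonneg (h.nonneg hs hC₁ hz)]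
  exact (h.2 z hz).2

lemma evenPowKernel.integrableOn_compl_ball (hs : s ∈ Ioo (0 : ℝ) 1) (hC₁ : 0 < C₁)
    (h : evenPowKernel n s C₁ C₂ K) (hK : AEStronglyMeasurable K) {δ : ℝ} (hδ : 0 < δ) :
    IntegrableOn K {z : En n | δ ≤ ‖z‖} :=
  Integrable.mono' ((integrableOn_norm_rpow_compl_ball n (by linarith [hs.1]) hδ).const_mul
    (C₂ * (s * (1 - s)))) hK.restrict ((ae_restrict_iff' (measurableSet_le_norm n δ)).2
    (ae_of_all _ fun _ hz => h.norm_le hs hC₁ (norm_pos_iff.1 (hδ.trans_le hz))))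

lemma evenPowKernel.sq_mul_norm_le (hs : s ∈ Ioo (0 : ℝ) 1) (hC₁ : 0 < C₁)
    (h : evenPowKernel n s C₁ C₂ K) (z : En n) :
    ‖‖z‖ ^ 2 * K z‖ ≤ C₂ * (s * (1 - s)) * (‖z‖ ^ 2 * ‖z‖ ^ (-((n : ℝ) + 2 * s))) := by
  rcases eq_or_ne z 0 with rfl | hz
  · simp
  · rw [norm_mul, norm_pow, norm_norm, mul_left_comm]
    exact mul_le_mul_of_nonneg_left (h.norm_le hs hC₁ hz) (by positivity)

lemma evenPowKernel.integrableOn_ball (hn : 0 < n) (hs : s ∈ Ioo (0 : ℝ) 1) (hC₁ : 0 < C₁)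
    (h : evenPowKernel n s C₁ C₂ K) (hK : AEStronglyMeasurable K) (r : ℝ) :
    IntegrableOn (fun z => ‖z‖ ^ 2 * K z) (ball (0 : En n) r) :=
  Integrable.mono' ((integrableOn_sq_mul_norm_rpow_ball n hn hs.2 r).const_mul
    (C₂ * (s * (1 - s))))
    ((measurable_norm.pow_const 2).aestronglyMeasurable.mul hK.restrict)
    (ae_of_all _ (h.sq_mul_norm_le hs hC₁))

lemma evenPowKernel.setIntegral_compl_ball_le (hs : s ∈ Ioo (0 : ℝ) 1) (hC₁ : 0 < C₁)
    (h : evenPowKernel n s C₁ C₂ K) (hK : AEStronglyMeasurable K) {δ : ℝ} (hδ : 0 < δ) :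
    ∫ z in {z : En n | δ ≤ ‖z‖}, K z ≤
      C₂ * (s * (1 - s)) * ∫ z in {z : En n | δ ≤ ‖z‖}, ‖z‖ ^ (-((n : ℝ) + 2 * s)) := by
  rw [← integral_const_mul]
  exact setIntegral_mono_on (h.integrableOn_compl_ball hs hC₁ hK hδ)
    ((integrableOn_norm_rpow_compl_ball n (by linarith [hs.1]) hδ).const_mul _)
    (measurableSet_le_norm n δ) fun z hz => (h.2 z (norm_pos_iff.1 (hδ.trans_le hz))).2

lemma evenPowKernel.setIntegral_ball_le (hn : 0 < n) (hs : s ∈ Ioo (0 : ℝ) 1) (hC₁ : 0 < C₁)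
    (h : evenPowKernel n s C₁ C₂ K) (hK : AEStronglyMeasurable K) (r : ℝ) :
    ∫ z in ball (0 : En n) r, ‖z‖ ^ 2 * K z ≤
      C₂ * (s * (1 - s)) *
        ∫ z in ball (0 : En n) r, ‖z‖ ^ 2 * ‖z‖ ^ (-((n : ℝ) + 2 * s)) := by
  rw [← integral_const_mul]
  exact setIntegral_mono_on (h.integrableOn_ball hn hs hC₁ hK r)
    ((integrableOn_sq_mul_norm_rpow_ball n hn hs.2 r).const_mul _) measurableSet_ball
    fun z _ => (le_abs_self _).trans (h.sq_mul_norm_le hs hC₁ z)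

end Kernel

lemma exists_bound_fderiv_bump {n : ℕ} (χ : ContDiffBump (0 : En n)) :
    ∃ D, ∀ z, ‖fderiv ℝ χ z‖ ≤ D :=
  ((χ.contDiff (n := 1)).continuous_fderiv (by norm_num)).bounded_above_of_compact_support
    (χ.hasCompactSupport.fderiv (𝕜 := ℝ))

lemma remainder_le {ε M Λ D κ I J : ℝ} (hε : 0 < ε) (hκ : 0 < κ) (hI : 0 ≤ I)
    (hJ : J < ε ^ 2 / (2 * (6 * M ^ 2 * κ + 1))) :
    6 * M ^ 2 * Λ ^ 2 * (κ * J) +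
      M ^ 4 * Λ ^ 2 * D ^ 2 / (2 * (M ^ 4 * D ^ 2 * (κ * I)) / ε ^ 2 + 1) * (κ * I) ≤
      ε ^ 2 * Λ ^ 2 := by
  have h1 : 6 * M ^ 2 * (κ * J) ≤ ε ^ 2 / 2 := by
    have h3 : 6 * M ^ 2 * κ * (ε ^ 2 / (2 * (6 * M ^ 2 * κ + 1))) ≤ ε ^ 2 / 2 := by
      rw [← mul_div_assoc, div_le_div_iff₀ (by positivity) two_pos]
      nlinarith [sq_nonneg ε]
    have h4 := mul_le_mul_of_nonneg_left hJ.le (show 0 ≤ 6 * M ^ 2 * κ by positivity)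
    linarith
  have h2 : M ^ 4 * D ^ 2 * (κ * I) / (2 * (M ^ 4 * D ^ 2 * (κ * I)) / ε ^ 2 + 1) ≤
      ε ^ 2 / 2 := by
    have h3 : ε ^ 2 / 2 * (2 * (M ^ 4 * D ^ 2 * (κ * I)) / ε ^ 2 + 1) =
        M ^ 4 * D ^ 2 * (κ * I) + ε ^ 2 / 2 := by
      field_simp
    rw [div_le_iff₀ (by positivity), h3]
    linarith [sq_nonneg ε]
  have h3 := mul_le_mul_of_nonneg_right (add_le_add h1 h2) (sq_nonneg Λ)
  calc _ = _ := by ring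
    _ ≤ _ := h3
    _ = _ := by ring

/-- The key inequality holds with remainder constant `ε ^ 2` for some `σ` depending only on `ε`,
the bound `M` on the cutoff and the structural constants. -/
lemma exists_key_inequality (n : ℕ) (hn : 0 < n) (s C₁ C₂ C₃ : ℝ) (hs : s ∈ Ioo (0 : ℝ) 1)
    (hC₁ : 0 < C₁) (hC₁₂ : C₁ ≤ C₂) (ε M : ℝ) :
    ∃ σ : ℝ, 0 < σ ∧ (0 < ε →
      ∀ K : En n → ℝ, evenPowKernel n s C₁ C₂ K → kernelDerivBdd n C₃ K →
      ∀ u η : En n → ℝ, ContDiff ℝ (⊤ : ℕ∞) u →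
        (∃ Mu : ℝ, ∀ x, |u x| ≤ Mu ∧ ‖fderiv ℝ u x‖ ≤ Mu) → ContDiff ℝ (⊤ : ℕ∞) η →
        C2BddBy n η M → ∀ e : En n, ‖e‖ = 1 →
      ∀ Λ : ℝ, (∀ x ∈ ball (0 : En n) 3, |dd n e u x| ≤ Λ) → ∀ x ∈ ball (0 : En n) 2,
        opK n K (fun y => (η y) ^ 2 * (dd n e u y) ^ 2 + σ * (u y) ^ 2) x ≤
          2 * (η x) ^ 2 * dd n e u x * opK n K (dd n e u) x
            + 2 * σ * u x * opK n K u x + ε ^ 2 * Λ ^ 2) := by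
  by_cases hε : 0 < ε
  swap
  · exact ⟨1, one_pos, fun h => absurd h hε⟩
  have hs1 : 0 < 1 - s := by linarith [hs.2]
  have hs0 := hs.1
  have hC₂ : 0 < C₂ := hC₁.trans_le hC₁₂
  set κ := C₂ * (s * (1 - s)) with hκ
  have hκ0 : 0 < κ := by positivity
  obtain ⟨r, hr0, hr1, hr⟩ := exists_setIntegral_ball_lt n hn hs.2
    (show 0 < ε ^ 2 / (2 * (6 * M ^ 2 * κ + 1)) by positivity)
  obtain ⟨χ, hχ⟩ : ∃ χ : ContDiffBump (0 : En n), χ.rOut = r :=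
    ⟨⟨r / 2, r, by positivity, by linarith⟩, rfl⟩
  rw [← hχ] at hr hr1
  obtain ⟨D₀, hD₀⟩ := exists_bound_fderiv_bump χ
  set D := C₃ / χ.rIn + D₀ with hD
  set I := ∫ z in {z : En n | χ.rIn ≤ ‖z‖}, ‖z‖ ^ (-((n : ℝ) + 2 * s)) with hI
  have hI0 : 0 ≤ I := integral_nonneg fun z => by positivity
  set σ := 2 * (M ^ 4 * D ^ 2 * (κ * I)) / ε ^ 2 + 1 with hσ
  have hσ0 : 0 < σ := by positivity
  clear_value σ I D
  refine ⟨σ, hσ0, fun _ K hK hK' u η hu hub hη hM e he Λ hΛ x hx => ?_⟩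
  obtain ⟨B, hB⟩ := hub
  have hKm := hK'.aestronglyMeasurable hn
  have hfar : ∀ δ, 0 < δ → IntegrableOn K {z : En n | δ ≤ ‖z‖} :=
    fun δ hδ => hK.integrableOn_compl_ball hs hC₁ hKm hδ
  have hnear := hK.integrableOn_ball hn hs hC₁ hKm 1
  have hB' : ∀ y, |dd n e u y| ≤ B := fun y =>
    ((fderiv ℝ u y).le_opNorm e).trans (by rw [he, mul_one]; exact (hB y).2)
  have hDK : ∀ z, χ.rIn ≤ ‖z‖ → |fderiv ℝ (farKernel n χ K) z e| ≤ D * K z := fun z hz =>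
    hD ▸ abs_fderiv_farKernel_le (fun z hz => hK'.differentiableAt hz)
      (fun z hz => hK.nonneg hs hC₁ hz)
      (fun z hz => le_trans (le_add_of_nonneg_right (by positivity)) (hK'.2 z hz)) hD₀ he hz
  have hΛ' : ∀ y ∈ ball x 1, |dd n e u y| ≤ Λ := fun y hy =>
    hΛ y (ball_subset_ball' (by linarith [mem_ball.1 hx]) hy)
  have hv := contDiff_dd hu e
  have hFb : ∀ y, |η y ^ 2 * dd n e u y ^ 2 + σ * u y ^ 2| ≤ M ^ 2 * B ^ 2 + σ * B ^ 2 :=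
    fun y => abs_sq_mul_sq_add_le hσ0.le (hM y).1 (hB' y) (hB y).1
  have hu2 := contDiff_infty.1 hu 2
  have hv2 := contDiff_infty.1 hv 2
  have hη2 := contDiff_infty.1 hη 2
  have tF := tendsto_opK hK.1 hKm hfar hnear
    (f := fun y => η y ^ 2 * dd n e u y ^ 2 + σ * u y ^ 2)
    (((hη2.pow 2).mul (hv2.pow 2)).add (contDiff_const.mul (hu2.pow 2))) hFb x
  have tV := tendsto_opK hK.1 hKm hfar hnear hv2 hB' x
  have tU := tendsto_opK hK.1 hKm hfar hnear hu2 (fun y => (hB y).1) x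
  have hlim := le_of_tendsto_of_tendsto tF
    (((tV.const_mul (2 * η x ^ 2 * dd n e u x)).add (tU.const_mul (2 * σ * u x))).add_const _)
    (by
      filter_upwards [Ioo_mem_nhdsGT χ.rIn_pos] with δ hδ
      exact truncated_key_inequality hK.1 (fun z hz => hK.nonneg hs hC₁ hz) hfar hnear
        (fun z hz => hK'.differentiableAt hz) hr1 hDK hu (fun y => (hB y).1) hB' hη hM hΛ' hσ0
        hδ.1 hδ.2.le)
  refine hlim.trans (add_le_add_right ?_ _)
  refine (add_le_add
    (mul_le_mul_of_nonneg_left (hK.setIntegral_ball_le hn hs hC₁ hKm χ.rOut) (by positivity))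
    (mul_le_mul_of_nonneg_left (hK.setIntegral_compl_ball_le hs hC₁ hKm χ.rIn_pos)
      (by positivity))).trans ?_
  rw [← hκ, ← hI, hσ]
  exact remainder_le hε hκ0 hI0 hr

/-- key inequality with a small remainder, for general kernels.
For every `ε > 0` there is `σ_ε > 0`, depending only on `ε`, (a bound `M` for)
`‖η‖_{C²(ℝⁿ)}`, and the structural constants `n, s, C₁, C₂, C₃`, such that
`𝓛_K(η²(∂_e u)² + σ_ε u²) ≤ 2η² ∂_e u 𝓛_K ∂_e u + 2σ_ε u 𝓛_K u + ε² ‖∂_e u‖²_{L^∞(B₃)}`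
everywhere in `B₂`, for every unit vector `e`. -/
theorem key_inequality_with_remainder (n : ℕ) (hn : 0 < n)
    (s C₁ C₂ C₃ : ℝ) (hs : s ∈ Set.Ioo (0:ℝ) 1)
    (hC₁ : 0 < C₁) (hC₁₂ : C₁ ≤ C₂) (hC₃ : 0 < C₃) :
    ∃ σfun : ℝ → ℝ → ℝ, (∀ ε M : ℝ, 0 < ε → 0 < σfun ε M) ∧
      ∀ (K : En n → ℝ), evenPowKernel n s C₁ C₂ K → kernelDerivBdd n C₃ K →
      ∀ (u η : En n → ℝ),
        ContDiff ℝ (⊤ : ℕ∞) u →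
        (∃ Mu : ℝ, ∀ x, |u x| ≤ Mu ∧ ‖fderiv ℝ u x‖ ≤ Mu) →
        ContDiff ℝ (⊤ : ℕ∞) η →
      ∀ (M : ℝ), C2BddBy n η M →
      ∀ (ε : ℝ), 0 < ε →
      ∀ (e : En n), ‖e‖ = 1 →
      ∀ (Λ : ℝ), 0 ≤ Λ → (∀ x ∈ ball (0 : En n) 3, |dd n e u x| ≤ Λ) →
      ∀ x ∈ ball (0 : En n) 2,
        opK n K (fun y => (η y)^2 * (dd n e u y)^2 + σfun ε M * (u y)^2) x ≤
          2 * (η x)^2 * dd n e u x * opK n K (dd n e u) x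
            + 2 * σfun ε M * u x * opK n K u x + ε^2 * Λ^2 := by
  choose σ hσ hkey using exists_key_inequality n hn s C₁ C₂ C₃ hs hC₁ hC₁₂
  exact ⟨σ, fun ε M _ => hσ ε M, fun K hK hK' u η hu hub hη M hM ε hε e he Λ _ hΛ x hx =>
    hkey ε M hε K hK hK' u η hu hub hη hM e he Λ hΛ x hx⟩
end
end
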